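/- Let Γ act conveniently (freely and properly discontinuously, with (i) ∃ c > 0 with d(x, γx) > c for all x and all γ ≠ 1, and (ii) a fundamental domain D with the r-neighbourhood covering property) by isometries on a separable proper metric space X with countable dense Γ-invariant subset Γ_X = ⋃_γ γD, and let Z ⊆ X be a closed Γ-invariant subset on which Γ acts cocompactly and such that Γ_X ∩ Z is dense in Z. Represent C₀(X) on H_X = ℓ²(Γ_X) ⊗ ℓ²(ℕ) and C₀(Z) on H_Z = ℓ²(Γ_X ∩ Z) ⊗ ℓ²(ℕ) by multiplication, and regard ℝ(Z)^Γ as a *-subalgebra of ℝ(X)^Γ via extension of operators by zero. Then every nondegenerate *-representation σ of ℝ(Z)^Γ on a Hilbert space H₀ extends to a nondegenerate *-representation of ℝ(X)^Γ: there exist a Hilbert space H', an isometry V : H₀ → H', and a nondegenerate *-representation σ̂ of ℝ(X)^Γ on H' with σ̂(T)V = Vσ(T) for all T ∈ ℝ(Z)^Γ. -/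

import Mathlib

open scoped ZeroAtInfty
open Metric Filter
open scoped Pointwise
open scoped Classical

noncomputable section

/-- `ℓ²(ℕ)`. -/
abbrev L2N : Type := lp (fun _ : ℕ => ℂ) 2

/-- `ℓ²(S) ⊗ ℓ²(ℕ)`, realised as `ℓ²(S, ℓ²(ℕ))` for a subset `S` of `X`. -/
abbrev L2S {X : Type*} (S : Set X) : Type _ := lp (fun _ : ↥S => L2N) 2

section OpDefs

variable {X : Type*} [MetricSpace X] {Γ : Type*} [Group Γ]
variable {H : Type*} [NormedAddCommGroup H] [InnerProductSpace ℂ H] [CompleteSpace H]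

/-- `T` has propagation at most `r` with respect to the representation `ρ` of `C₀(X)`. -/
def HasPropLE (ρ : C₀(X, ℂ) →⋆ₙₐ[ℂ] (H →L[ℂ] H)) (T : H →L[ℂ] H) (r : ℝ) : Prop :=
  ∀ f g : C₀(X, ℂ),
    (∀ x ∈ tsupport ⇑f, ∀ y ∈ tsupport ⇑g, r ≤ dist x y) → ρ f * T * ρ g = 0

/-- `T` is locally compact with respect to `ρ`. -/
def IsLocCompactOp (ρ : C₀(X, ℂ) →⋆ₙₐ[ℂ] (H →L[ℂ] H)) (T : H →L[ℂ] H) : Prop :=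
  ∀ f : C₀(X, ℂ), IsCompactOperator ⇑(ρ f * T) ∧ IsCompactOperator ⇑(T * ρ f)

/-- `T` is invariant under the unitary representation `u` of `Γ`. -/
def IsEquivariantOp (u : Γ →* unitary (H →L[ℂ] H)) (T : H →L[ℂ] H) : Prop :=
  ∀ γ : Γ, (u γ : H →L[ℂ] H) * T = T * (u γ : H →L[ℂ] H)

/-- The algebraic equivariant Roe algebra `ℝ(X)^Γ`. -/
def RoeAlgSet (ρ : C₀(X, ℂ) →⋆ₙₐ[ℂ] (H →L[ℂ] H)) (u : Γ →* unitary (H →L[ℂ] H)) :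
    Set (H →L[ℂ] H) :=
  {T | IsEquivariantOp u T ∧ IsLocCompactOp ρ T ∧ ∃ r : ℝ, 0 ≤ r ∧ HasPropLE ρ T r}

/-- `σ` is a `*`-representation of the `*`-algebra given by the subset `R ⊆ B(H)`. -/
def IsStarRepOn {H' : Type*} [NormedAddCommGroup H'] [InnerProductSpace ℂ H']
    [CompleteSpace H'] (R : Set (H →L[ℂ] H)) (σ : (H →L[ℂ] H) → (H' →L[ℂ] H')) : Prop :=
  (∀ T ∈ R, ∀ S ∈ R, σ (T + S) = σ T + σ S) ∧
  (∀ (c : ℂ), ∀ T ∈ R, σ (c • T) = c • σ T) ∧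
  (∀ T ∈ R, ∀ S ∈ R, σ (T * S) = σ T * σ S) ∧
  (∀ T ∈ R, σ (star T) = star (σ T))

/-- `σ` is a nondegenerate representation of the set `R ⊆ B(H)` on `H'`. -/
def IsNondegRepOn {H' : Type*} [NormedAddCommGroup H'] [InnerProductSpace ℂ H']
    [CompleteSpace H'] (R : Set (H →L[ℂ] H)) (σ : (H →L[ℂ] H) → (H' →L[ℂ] H')) : Prop :=
  Dense (Submodule.span ℂ {w : H' | ∃ T ∈ R, ∃ v : H', σ T v = w} : Set H')

end OpDefs

/-- `T'` on `ℓ²(Γ_X) ⊗ ℓ²(ℕ)` is the extension by zero of `T` on `ℓ²(Γ_X ∩ Z) ⊗ ℓ²(ℕ)`. -/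
def ExtZeroRel {X : Type*} [MetricSpace X] (ΓX Z : Set X)
    (T : L2S (ΓX ∩ Z) →L[ℂ] L2S (ΓX ∩ Z)) (T' : L2S ΓX →L[ℂ] L2S ΓX) : Prop :=
  (∀ (y x : ↥(ΓX ∩ Z)) (ξ : L2N),
    (T' (lp.single 2 (⟨(y : X), y.2.1⟩ : ↥ΓX) ξ)) (⟨(x : X), x.2.1⟩ : ↥ΓX)
      = (T (lp.single 2 y ξ)) x) ∧
  (∀ y : ↥ΓX, (y : X) ∉ Z → ∀ ξ : L2N, T' (lp.single 2 y ξ) = 0) ∧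
  (∀ (y : ↥(ΓX ∩ Z)) (ξ : L2N) (x : ↥ΓX), (x : X) ∉ Z →
    (T' (lp.single 2 (⟨(y : X), y.2.1⟩ : ↥ΓX) ξ)) x = 0)

/-- A witness that a representation `σ` of the subalgebra `RZ` (acting on `HZ`) extends,
along an isometry into a possibly bigger Hilbert space, to a nondegenerate
`*`-representation of `RX` (acting on `HX`), where `Ext` identifies elements of `RZ` with
their images in `RX`. -/
structure RepExtensionWitness
    {HZ HX H₀ : Type*}
    [NormedAddCommGroup HZ] [InnerProductSpace ℂ HZ] [CompleteSpace HZ]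
    [NormedAddCommGroup HX] [InnerProductSpace ℂ HX] [CompleteSpace HX]
    [NormedAddCommGroup H₀] [InnerProductSpace ℂ H₀] [CompleteSpace H₀]
    (RZ : Set (HZ →L[ℂ] HZ)) (RX : Set (HX →L[ℂ] HX))
    (Ext : (HZ →L[ℂ] HZ) → (HX →L[ℂ] HX) → Prop)
    (σ : (HZ →L[ℂ] HZ) → (H₀ →L[ℂ] H₀)) where
  carrier : Type
  [cNorm : NormedAddCommGroup carrier]
  [cInner : InnerProductSpace ℂ carrier]
  [cComplete : CompleteSpace carrier]
  isom : H₀ →ₗᵢ[ℂ] carrier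
  hatRep : (HX →L[ℂ] HX) → (carrier →L[ℂ] carrier)
  isStarRep : IsStarRepOn RX hatRep
  isNondeg : IsNondegRepOn RX hatRep
  intertwines : ∀ T ∈ RZ, ∀ T' : HX →L[ℂ] HX, Ext T T' →
    ∀ w : H₀, hatRep T' (isom w) = isom (σ T w)

set_option linter.unusedSectionVars false

section Multipliers

variable {H : Type*} [NormedAddCommGroup H] [InnerProductSpace ℂ H] [CompleteSpace H]
variable {H₀ : Type*} [NormedAddCommGroup H₀] [InnerProductSpace ℂ H₀] [CompleteSpace H₀]

/-- `A` is a `*`-closed subspace of the star-closed set `M`, and `A` absorbs left multiplication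
by elements of `M`. -/
structure IsMultiplierPair (A M : Set (H →L[ℂ] H)) : Prop where
  add_mem : ∀ a ∈ A, ∀ b ∈ A, a + b ∈ A
  smul_mem : ∀ (c : ℂ), ∀ a ∈ A, c • a ∈ A
  star_mem : ∀ a ∈ A, star a ∈ A
  subset : A ⊆ M
  star_mem_multiplier : ∀ b ∈ M, star b ∈ M
  mul_mem : ∀ b ∈ M, ∀ a ∈ A, b * a ∈ A

/-- `S` is the operator by which the multiplier `b` of `A` acts in the representation `σ`. -/
def Implements (A : Set (H →L[ℂ] H)) (σ : (H →L[ℂ] H) → (H₀ →L[ℂ] H₀)) (b : H →L[ℂ] H)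
    (S : H₀ →L[ℂ] H₀) : Prop :=
  ∀ a ∈ A, ∀ v, S (σ a v) = σ (b * a) v

variable {A M : Set (H →L[ℂ] H)} {σ : (H →L[ℂ] H) → (H₀ →L[ℂ] H₀)} {b c : H →L[ℂ] H}
  {S S' : H₀ →L[ℂ] H₀}

theorem clm_eq_of_nondeg (hnd : IsNondegRepOn A σ) (h : ∀ a ∈ A, ∀ v, S (σ a v) = S' (σ a v)) :
    S = S' := by
  refine ContinuousLinearMap.ext_on hnd ?_
  rintro _ ⟨a, ha, v, rfl⟩
  exact h a ha v

namespace Implements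

theorem unique (hnd : IsNondegRepOn A σ) (h : Implements A σ b S) (h' : Implements A σ b S') :
    S = S' :=
  clm_eq_of_nondeg hnd fun a ha v => by rw [h a ha, h' a ha]

theorem self (hσ : IsStarRepOn A σ) (hb : b ∈ A) : Implements A σ b (σ b) := fun a ha v => by
  rw [hσ.2.2.1 b hb a ha]; rfl

theorem one : Implements A σ 1 (1 : H₀ →L[ℂ] H₀) := fun a _ v => by simp

theorem add (hA : IsMultiplierPair A M) (hσ : IsStarRepOn A σ) (hb : b ∈ M) (hc : c ∈ M)
    (h : Implements A σ b S) (h' : Implements A σ c S') : Implements A σ (b + c) (S + S') :=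
  fun a ha v => by
    rw [add_mul, hσ.1 _ (hA.mul_mem b hb a ha) _ (hA.mul_mem c hc a ha)]
    simp [h a ha, h' a ha]

theorem smul (hA : IsMultiplierPair A M) (hσ : IsStarRepOn A σ) (hb : b ∈ M) (k : ℂ)
    (h : Implements A σ b S) : Implements A σ (k • b) (k • S) :=
  fun a ha v => by
    rw [smul_mul_assoc, hσ.2.1 _ _ (hA.mul_mem b hb a ha)]
    simp [h a ha]

theorem mul (hA : IsMultiplierPair A M) (hc : c ∈ M)
    (h : Implements A σ b S) (h' : Implements A σ c S') : Implements A σ (b * c) (S * S') :=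
  fun a ha v => by
    rw [mul_apply_eq_comp, h' a ha, h _ (hA.mul_mem c hc a ha), mul_assoc]

theorem inner_eq (hA : IsMultiplierPair A M) (hσ : IsStarRepOn A σ) (hb : b ∈ M)
    {a a' : H →L[ℂ] H} (ha : a ∈ A) (ha' : a' ∈ A) (v w : H₀) :
    inner ℂ (σ (b * a) v) (σ a' w) = inner ℂ (σ a v) (σ (star b * a') w) := by
  have key : ∀ x ∈ A, ∀ y ∈ A, inner ℂ (σ x v) (σ y w) = inner ℂ v (σ (star x * y) w) := by
    intro x hx y hy
    rw [hσ.2.2.1 _ (hA.star_mem x hx) y hy, hσ.2.2.2 x hx, ContinuousLinearMap.star_eq_adjoint,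
      mul_apply_eq_comp, ContinuousLinearMap.adjoint_inner_right]
  rw [key _ (hA.mul_mem b hb a ha) _ ha',
    key _ ha _ (hA.mul_mem _ (hA.star_mem_multiplier b hb) a' ha'), star_mul, mul_assoc]

theorem star (hA : IsMultiplierPair A M) (hσ : IsStarRepOn A σ) (hnd : IsNondegRepOn A σ)
    (hb : b ∈ M) (h : Implements A σ b S) : Implements A σ (star b) (star S) := by
  intro a ha v
  refine ext_inner_right ℂ fun w => ?_
  have : innerSL ℂ (Star.star S (σ a v)) = innerSL ℂ (σ (Star.star b * a) v) := by
    refine ContinuousLinearMap.ext_on hnd ?_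
    rintro _ ⟨a', ha', v', rfl⟩
    simp only [innerSL_apply_apply]
    rw [inner_eq hA hσ (hA.star_mem_multiplier b hb) ha ha', star_star,
      ContinuousLinearMap.star_eq_adjoint, ContinuousLinearMap.adjoint_inner_left, h a' ha']
  exact congrArg (fun f => f w) this

/-- A multiplier dominated by `1`, with complement of the form `star c * c`, acts boundedly. -/
theorem exists_of_star_mul_add (hA : IsMultiplierPair A M) (hσ : IsStarRepOn A σ)
    (hnd : IsNondegRepOn A σ) (hb : b ∈ M) (hc : c ∈ M)
    (hbc : Star.star b * b + Star.star c * c = 1) : ∃ S, Implements A σ b S := by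
  let q : (H →L[ℂ] H) → (A →₀ H₀) →ₗ[ℂ] H₀ := fun m =>
    Finsupp.lsum ℂ fun a : A => (σ (m * a)).toLinearMap
  have hq : ∀ m (a : A) v, q m (Finsupp.single a v) = σ (m * a) v := by
    intro m a v
    simp [q]
  have hinner : ∀ t s, inner ℂ (q b t) (q b s) + inner ℂ (q c t) (q c s)
      = inner ℂ (q 1 t) (q 1 s) := by
    intro t s
    induction t using Finsupp.induction_linear with
    | zero => simp
    | add f g hf hg =>
      simp only [map_add, inner_add_left, ← hf, ← hg]
      ring
    | single a v =>
      induction s using Finsupp.induction_linear with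
      | zero => simp
      | add f g hf hg =>
        simp only [map_add, inner_add_right, ← hf, ← hg]
        ring
      | single a' w =>
        simp only [hq, one_mul]
        rw [inner_eq hA hσ hb a.2 (hA.mul_mem b hb _ a'.2),
          inner_eq hA hσ hc a.2 (hA.mul_mem c hc _ a'.2), ← inner_add_right,
          ← add_apply, ← hσ.1 _
          (hA.mul_mem _ (hA.star_mem_multiplier b hb) _ (hA.mul_mem b hb _ a'.2)) _
          (hA.mul_mem _ (hA.star_mem_multiplier c hc) _ (hA.mul_mem c hc _ a'.2)),
          ← mul_assoc, ← mul_assoc, ← add_mul, hbc, one_mul]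
  have hnorm : ∀ t, ‖q b t‖ ≤ 1 * ‖q 1 t‖ := by
    intro t
    have h := congrArg (RCLike.re : ℂ → ℝ) (hinner t t)
    simp only [map_add, inner_self_eq_norm_sq] at h
    rw [one_mul]
    refine le_of_sq_le_sq ?_ (norm_nonneg _)
    nlinarith [sq_nonneg ‖q c t‖]
  have hdense : DenseRange (q 1) := by
    refine hnd.mono ?_
    have : Submodule.span ℂ {w : H₀ | ∃ T ∈ A, ∃ v : H₀, σ T v = w} ≤ LinearMap.range (q 1) := by
      rw [Submodule.span_le]
      rintro _ ⟨T, hT, v, rfl⟩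
      exact ⟨Finsupp.single ⟨T, hT⟩ v, by simp [hq]⟩
    exact fun x hx => this hx
  refine ⟨(q b).extendOfNorm (q 1), fun a ha v => ?_⟩
  have := LinearMap.extendOfNorm_eq hdense ⟨1, hnorm⟩ (Finsupp.single ⟨a, ha⟩ v)
  simpa [hq] using this

end Implements

end Multipliers
section Essential

/-- A `*`-representation restricts to a nondegenerate one on its essential subspace, so an
extension of `σ` along an isometry can always be made nondegenerate. -/
theorem nonempty_repExtensionWitness {HZ HX : Type*} {H₀ : Type}
    [NormedAddCommGroup HZ] [InnerProductSpace ℂ HZ] [CompleteSpace HZ]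
    [NormedAddCommGroup HX] [InnerProductSpace ℂ HX] [CompleteSpace HX]
    [NormedAddCommGroup H₀] [InnerProductSpace ℂ H₀] [CompleteSpace H₀]
    {RZ : Set (HZ →L[ℂ] HZ)} {RX : Set (HX →L[ℂ] HX)}
    {Ext : (HZ →L[ℂ] HZ) → (HX →L[ℂ] HX) → Prop}
    {σ : (HZ →L[ℂ] HZ) → (H₀ →L[ℂ] H₀)} {τ : (HX →L[ℂ] HX) → (H₀ →L[ℂ] H₀)}
    (hσ : IsNondegRepOn RZ σ) (hτ : IsStarRepOn RX τ) (hstar : ∀ T ∈ RX, star T ∈ RX)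
    (hExt : ∀ T ∈ RZ, ∃ T' ∈ RX, Ext T T') (V : H₀ →ₗᵢ[ℂ] H₀)
    (hV : ∀ T ∈ RZ, ∀ T' : HX →L[ℂ] HX, Ext T T' → ∀ w : H₀, τ T' (V w) = V (σ T w)) :
    Nonempty (RepExtensionWitness RZ RX Ext σ) := by
  let N : Submodule ℂ H₀ := Submodule.span ℂ {w : H₀ | ∃ T ∈ RX, ∃ v : H₀, τ T v = w}
  let K : Submodule ℂ H₀ := N.topologicalClosure
  have hK : IsClosed (K : Set H₀) := N.isClosed_topologicalClosure
  have : CompleteSpace K := hK.completeSpace_coe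
  have hτK : ∀ T ∈ RX, ∀ v, τ T v ∈ K := fun T hT v =>
    N.le_topologicalClosure (Submodule.subset_span ⟨T, hT, v, rfl⟩)
  have hVK : ∀ w, V w ∈ K := by
    have hcl : IsClosed (V ⁻¹' (K : Set H₀)) := hK.preimage V.continuous
    have hspan : Submodule.span ℂ {w : H₀ | ∃ T ∈ RZ, ∃ v : H₀, σ T v = w}
        ≤ K.comap V.toLinearMap := by
      rw [Submodule.span_le]
      rintro _ ⟨T, hT, v, rfl⟩
      obtain ⟨T', hT', hTT'⟩ := hExt T hT
      change V (σ T v) ∈ K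
      rw [← hV T hT T' hTT' v]
      exact hτK T' hT' _
    intro w
    exact hcl.closure_subset_iff.2 (fun x hx => hspan hx) (hσ w)
  let P : H₀ →L[ℂ] K := K.orthogonalProjectionOnto
  let τK : (HX →L[ℂ] HX) → (K →L[ℂ] K) := fun T => P ∘L τ T ∘L K.subtypeL
  have hτK_coe : ∀ T ∈ RX, ∀ v : K, ((τK T v : K) : H₀) = τ T v := fun T hT v =>
    K.starProjection_eq_self_iff.2 (hτK T hT v)
  have hstarK : ∀ T ∈ RX, τK (star T) = star (τK T) := by
    intro T hT
    simp only [τK, P, ContinuousLinearMap.star_eq_adjoint, ContinuousLinearMap.adjoint_comp,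
      Submodule.adjoint_subtypeL, Submodule.adjoint_orthogonalProjectionOnto]
    rw [← ContinuousLinearMap.star_eq_adjoint, hτ.2.2.2 T hT, ContinuousLinearMap.comp_assoc,
      ContinuousLinearMap.star_eq_adjoint]
  refine ⟨{
    carrier := K
    isom := ⟨V.toLinearMap.codRestrict K hVK, fun w => V.norm_map w⟩
    hatRep := τK
    isStarRep := ⟨?_, ?_, ?_, hstarK⟩
    isNondeg := ?_
    intertwines := ?_ }⟩
  · intro T hT S hS
    simp only [τK, hτ.1 T hT S hS, ContinuousLinearMap.add_comp, ContinuousLinearMap.comp_add]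
  · intro c T hT
    simp only [τK, hτ.2.1 c T hT, ContinuousLinearMap.smul_comp, ContinuousLinearMap.comp_smul]
  · intro T hT S hS
    ext v
    have h1 : τK (T * S) v = P (τ T (τ S v)) := by
      simp [τK, hτ.2.2.1 T hT S hS]
    have h2 : (τK T * τK S) v = P (τ T ((τK S v : K) : H₀)) := rfl
    rw [h1, h2, hτK_coe S hS]
  · refine (Submodule.dense_iff_topologicalClosure_eq_top).2
      ((Submodule.topologicalClosure_eq_top_iff).2 ((Submodule.eq_bot_iff _).2 fun x hx => ?_))
    have hx0 : ∀ T ∈ RX, τK T x = 0 := by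
      intro T hT
      refine ext_inner_right ℂ fun v => ?_
      have h := (Submodule.mem_orthogonal' _ _).1 hx (τK (star T) v)
        (Submodule.subset_span ⟨star T, hstar T hT, v, rfl⟩)
      rwa [hstarK T hT, ContinuousLinearMap.star_eq_adjoint,
        ContinuousLinearMap.adjoint_inner_right, ← inner_zero_left v] at h
    have hN : N ≤ (ℂ ∙ (x : H₀))ᗮ := by
      rw [Submodule.span_le]
      rintro _ ⟨T, hT, v, rfl⟩
      refine Submodule.mem_orthogonal_singleton_iff_inner_right.2 ?_
      have h := congrArg (fun y : K => inner ℂ (y : H₀) v) (hx0 (star T) (hstar T hT))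
      simp only [hτK_coe _ (hstar T hT)] at h
      rw [hτ.2.2.2 T hT, ContinuousLinearMap.star_eq_adjoint,
        ContinuousLinearMap.adjoint_inner_left] at h
      simpa using h
    have hKx : (x : H₀) ∈ (ℂ ∙ (x : H₀))ᗮ :=
      N.topologicalClosure_minimal hN (Submodule.isClosed_orthogonal _) x.2
    have := Submodule.mem_orthogonal_singleton_iff_inner_right.1 hKx
    exact Subtype.ext (inner_self_eq_zero.1 this)
  · intro T hT T' hTT' w
    change P (τ T' (V w)) = _
    rw [hV T hT T' hTT' w]
    exact Subtype.ext (K.starProjection_eq_self_iff.2 (hVK _))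

end Essential

/-- The adjoint of a compact operator between Hilbert spaces is compact. -/
theorem IsCompactOperator.adjoint {E F : Type*} [NormedAddCommGroup E] [InnerProductSpace ℂ E]
    [CompleteSpace E] [NormedAddCommGroup F] [InnerProductSpace ℂ F] [CompleteSpace F]
    {T : E →L[ℂ] F} (hT : IsCompactOperator T) :
    IsCompactOperator (ContinuousLinearMap.adjoint T) := by
  have hTT : IsCompactOperator (T ∘L ContinuousLinearMap.adjoint T) := hT.comp_clm _
  refine (isCompactOperator_iff_isCompact_closure_image_closedBall
    ((ContinuousLinearMap.adjoint T : F →L[ℂ] E) : F →ₗ[ℂ] E) one_pos).2 ?_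
  have htb := ((isCompactOperator_iff_isCompact_closure_image_closedBall
    ((T ∘L ContinuousLinearMap.adjoint T : F →L[ℂ] F) : F →ₗ[ℂ] F) one_pos).1
      hTT).totallyBounded.subset subset_closure
  refine TotallyBounded.isCompact_of_isClosed (TotallyBounded.closure ?_) isClosed_closure
  refine Metric.totallyBounded_iff.2 fun ε hε => ?_
  obtain ⟨t, hts, htf, hcov⟩ := Metric.finite_approx_of_totallyBounded htb (ε ^ 2 / 2)
    (by positivity)
  obtain ⟨s, hs, hsf, rfl⟩ := Set.exists_subset_image_finite_and.1 ⟨t, hts, htf, rfl⟩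
  refine ⟨_, hsf.image (ContinuousLinearMap.adjoint T), ?_⟩
  rintro _ ⟨v, hv, rfl⟩
  obtain ⟨y, hy, hvy⟩ := Set.mem_iUnion₂.1 (hcov ⟨v, hv, rfl⟩)
  obtain ⟨w, hw, rfl⟩ := hy
  refine Set.mem_iUnion₂.2 ⟨_, ⟨w, hw, rfl⟩, ?_⟩
  rw [Metric.mem_ball, dist_eq_norm] at hvy ⊢
  rw [← map_sub] at hvy
  change ‖ContinuousLinearMap.adjoint T v - ContinuousLinearMap.adjoint T w‖ < ε
  rw [← map_sub]
  have hvw : ‖v - w‖ ≤ 2 := by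
    have h1 := mem_closedBall_zero_iff.1 hv
    have h2 := mem_closedBall_zero_iff.1 (hs hw)
    linarith [norm_sub_le v w]
  have key : ‖ContinuousLinearMap.adjoint T (v - w)‖ ^ 2
      ≤ ‖T (ContinuousLinearMap.adjoint T (v - w))‖ * ‖v - w‖ := by
    rw [← inner_self_eq_norm_sq (𝕜 := ℂ), ContinuousLinearMap.adjoint_inner_right]
    exact (RCLike.re_le_norm _).trans (norm_inner_le_norm _ _)
  have hvy' : ‖T (ContinuousLinearMap.adjoint T (v - w))‖ < ε ^ 2 / 2 := hvy
  refine lt_of_pow_lt_pow_left₀ 2 hε.le ?_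
  change ‖ContinuousLinearMap.adjoint T (v - w)‖ ^ 2 < ε ^ 2
  nlinarith [norm_nonneg (T (ContinuousLinearMap.adjoint T (v - w))), norm_nonneg (v - w)]

section Blocks

variable {α β F F' : Type*} [DecidableEq α] [DecidableEq β]
  [NormedAddCommGroup F] [InnerProductSpace ℂ F] [CompleteSpace F]
  [NormedAddCommGroup F'] [InnerProductSpace ℂ F'] [CompleteSpace F']

theorem lp_clm_ext {E : Type*} [NormedAddCommGroup E] [InnerProductSpace ℂ E]
    {S T : lp (fun _ : α => F) 2 →L[ℂ] E}
    (h : ∀ a ξ, S (lp.single 2 a ξ) = T (lp.single 2 a ξ)) : S = T := by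
  ext v
  have hv := lp.hasSum_single (p := 2) (by simp) v
  refine (hv.mapL S).unique ?_
  simpa only [h] using hv.mapL T

theorem lp_clm_apply_eq_zero {T : lp (fun _ : α => F) 2 →L[ℂ] lp (fun _ : β => F') 2}
    {v : lp (fun _ : α => F) 2} {x : β} (h : ∀ y, T (lp.single 2 y (v y)) x = 0) :
    T v x = 0 := by
  have hv := lp.hasSum_single (p := 2) (by simp) v
  have := (hv.mapL T).mapL (lp.evalCLM ℂ (fun _ : β => F') 2 x)
  refine this.unique ?_
  convert hasSum_zero with y
  exact h y

theorem inner_lp_single_left (a : α) (ξ : F) (v : lp (fun _ : α => F) 2) :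
    inner ℂ (lp.single 2 a ξ) v = inner ℂ ξ (v a) :=
  lp.inner_single_left (G := fun _ : α => F) a ξ v

/-- Placing a vector at a given index, as a linear isometry. -/
def singleIsom (b : β) : F' →ₗᵢ[ℂ] lp (fun _ : β => F') 2 where
  toLinearMap := (lp.singleContinuousLinearMap ℂ (fun _ : β => F') 2 b).toLinearMap
  norm_map' ξ := lp.norm_single (E := fun _ : β => F') (by norm_num) b ξ

@[simp]
theorem singleIsom_apply (b : β) (ξ : F') : singleIsom b ξ = lp.single 2 b ξ := rfl

/-- The isometry sending `ξ` placed at `a` to `U a ξ` placed at `f a`. -/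
def blockIsom (f : α → β) (U : α → F →ₗᵢ[ℂ] F')
    (h : ∀ a b, a ≠ b → f a = f b → ∀ ξ η, inner ℂ (U a ξ) (U b η) = 0) :
    lp (fun _ : α => F) 2 →ₗᵢ[ℂ] lp (fun _ : β => F') 2 :=
  OrthogonalFamily.linearIsometry (G := fun _ : α => F)
    (V := fun a => (singleIsom (f a)).comp (U a)) (by
      intro a b hab ξ η
      change inner ℂ (singleIsom (f a) (U a ξ)) (singleIsom (f b) (U b η)) = 0
      rw [singleIsom_apply, singleIsom_apply, inner_lp_single_left]
      by_cases hf : f a = f b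
      · rw [hf, lp.single_apply_self]
        exact h a b hab hf ξ η
      · rw [lp.single_apply_ne _ _ _ hf, inner_zero_right])

variable {f : α → β} {U : α → F →ₗᵢ[ℂ] F'}
  {h : ∀ a b, a ≠ b → f a = f b → ∀ ξ η, inner ℂ (U a ξ) (U b η) = 0}

@[simp]
theorem blockIsom_single (a : α) (ξ : F) :
    blockIsom f U h (lp.single 2 a ξ) = lp.single 2 (f a) (U a ξ) :=
  OrthogonalFamily.linearIsometry_apply_single (G := fun _ : α => F) _ ξ

theorem blockIsom_apply_eq_zero {v : lp (fun _ : α => F) 2} {b : β}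
    (hv : ∀ a, f a = b → v a = 0) : blockIsom f U h v b = 0 := by
  refine lp_clm_apply_eq_zero (T := (blockIsom f U h).toContinuousLinearMap) fun a => ?_
  change blockIsom f U h (lp.single 2 a (v a)) b = 0
  rw [blockIsom_single]
  by_cases hab : f a = b
  · simp [hv a hab]
  · exact lp.single_apply_ne _ _ _ (Ne.symm hab)

theorem blockIsom_apply (hf : f.Injective) (v : lp (fun _ : α => F) 2) (a : α) :
    blockIsom f U h v (f a) = U a (v a) := by
  have : (lp.evalCLM ℂ (fun _ : β => F') 2 (f a)) ∘L (blockIsom f U h).toContinuousLinearMap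
      = (U a).toContinuousLinearMap ∘L lp.evalCLM ℂ (fun _ : α => F) 2 a := by
    refine lp_clm_ext fun b ξ => ?_
    change blockIsom f U h (lp.single 2 b ξ) (f a) = U a (lp.single (E := fun _ => F) 2 b ξ a)
    rw [blockIsom_single]
    by_cases hab : a = b
    · subst hab
      simp
    · rw [lp.single_apply_ne _ _ _ hab, lp.single_apply_ne _ _ _ (hf.ne hab), map_zero]
  exact congrArg (fun S => S v) this

theorem blockIsom_adjoint_apply (v : lp (fun _ : β => F') 2) (a : α) :
    (ContinuousLinearMap.adjoint (blockIsom f U h).toContinuousLinearMap v) a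
      = ContinuousLinearMap.adjoint (U a).toContinuousLinearMap (v (f a)) := by
  refine ext_inner_left (E := F) ℂ fun ξ => ?_
  refine (inner_lp_single_left a ξ _).symm.trans ?_
  rw [ContinuousLinearMap.adjoint_inner_right, ContinuousLinearMap.adjoint_inner_right]
  change inner ℂ (blockIsom f U h (lp.single 2 a ξ)) v = inner ℂ (U a ξ) (v (f a))
  rw [blockIsom_single, inner_lp_single_left]

theorem blockIsom_adjoint_single (hf : f.Injective) (a : α) (ξ : F') :
    ContinuousLinearMap.adjoint (blockIsom f U h).toContinuousLinearMap (lp.single 2 (f a) ξ)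
      = lp.single 2 a (ContinuousLinearMap.adjoint (U a).toContinuousLinearMap ξ) := by
  ext b : 2
  rw [blockIsom_adjoint_apply]
  by_cases hab : b = a
  · subst hab
    rw [lp.single_apply_self, lp.single_apply_self]
  · rw [lp.single_apply_ne _ _ _ hab, lp.single_apply_ne _ _ _ (hf.ne hab), map_zero]

theorem blockIsom_adjoint_single_of_notMem {b : β} (hb : ∀ a, f a ≠ b) (ξ : F') :
    ContinuousLinearMap.adjoint (blockIsom f U h).toContinuousLinearMap (lp.single 2 b ξ) = 0 := by
  ext a : 2
  rw [blockIsom_adjoint_apply, lp.single_apply_ne _ _ _ (hb a), map_zero]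
  rfl

/-- Extension by zero along an injective map. -/
def extendIsom (F : Type*) [NormedAddCommGroup F] [InnerProductSpace ℂ F] [CompleteSpace F]
    (f : α → β) (hf : f.Injective) : lp (fun _ : α => F) 2 →ₗᵢ[ℂ] lp (fun _ : β => F) 2 :=
  blockIsom f (fun _ => LinearIsometry.id) fun _ _ hab h => (hab (hf h)).elim

theorem adjoint_id_toContinuousLinearMap :
    ContinuousLinearMap.adjoint (LinearIsometry.id : F →ₗᵢ[ℂ] F).toContinuousLinearMap = 1 := by
  change ContinuousLinearMap.adjoint (ContinuousLinearMap.id ℂ F) = _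
  rw [← ContinuousLinearMap.one_def, ← ContinuousLinearMap.star_eq_adjoint, star_one]

section Extend

variable {f : α → β} {hf : f.Injective}

@[simp]
theorem extendIsom_single (a : α) (ξ : F) :
    extendIsom F f hf (lp.single 2 a ξ) = lp.single 2 (f a) ξ :=
  blockIsom_single a ξ

theorem extendIsom_apply (v : lp (fun _ : α => F) 2) (a : α) :
    extendIsom F f hf v (f a) = v a :=
  blockIsom_apply hf v a

theorem extendIsom_apply_of_notMem (v : lp (fun _ : α => F) 2) {b : β} (hb : ∀ a, f a ≠ b) :
    extendIsom F f hf v b = 0 :=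
  blockIsom_apply_eq_zero fun a ha => (hb a ha).elim

theorem extendIsom_adjoint_apply (v : lp (fun _ : β => F) 2) (a : α) :
    ContinuousLinearMap.adjoint (extendIsom F f hf).toContinuousLinearMap v a = v (f a) := by
  refine (blockIsom_adjoint_apply v a).trans ?_
  rw [adjoint_id_toContinuousLinearMap]
  rfl

theorem extendIsom_adjoint_single (a : α) (ξ : F) :
    ContinuousLinearMap.adjoint (extendIsom F f hf).toContinuousLinearMap (lp.single 2 (f a) ξ)
      = lp.single 2 a ξ := by
  refine (blockIsom_adjoint_single hf a ξ).trans ?_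
  rw [adjoint_id_toContinuousLinearMap]
  rfl

theorem extendIsom_adjoint_single_of_notMem {b : β} (hb : ∀ a, f a ≠ b) (ξ : F) :
    ContinuousLinearMap.adjoint (extendIsom F f hf).toContinuousLinearMap (lp.single 2 b ξ) = 0 :=
  blockIsom_adjoint_single_of_notMem hb ξ

end Extend

/-- The projection onto the vectors supported in `s`. -/
def restrictProj (F : Type*) [NormedAddCommGroup F] [InnerProductSpace ℂ F] [CompleteSpace F]
    (s : Set α) : lp (fun _ : α => F) 2 →L[ℂ] lp (fun _ : α => F) 2 :=
  (extendIsom F (Subtype.val : s → α) Subtype.val_injective).toContinuousLinearMap ∘L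
    ContinuousLinearMap.adjoint
      (extendIsom F (Subtype.val : s → α) Subtype.val_injective).toContinuousLinearMap

theorem restrictProj_apply_of_mem {s : Set α} (v : lp (fun _ : α => F) 2) {a : α} (ha : a ∈ s) :
    restrictProj F s v a = v a :=
  (extendIsom_apply (hf := Subtype.val_injective) _ (⟨a, ha⟩ : s)).trans
    (extendIsom_adjoint_apply v _)

theorem restrictProj_apply_of_notMem {s : Set α} (v : lp (fun _ : α => F) 2) {a : α}
    (ha : a ∉ s) : restrictProj F s v a = 0 :=
  extendIsom_apply_of_notMem (hf := Subtype.val_injective) _ fun b hb => ha (hb ▸ b.2)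

theorem adjoint_restrictProj (s : Set α) :
    ContinuousLinearMap.adjoint (restrictProj F s) = restrictProj F s := by
  rw [restrictProj, ContinuousLinearMap.adjoint_comp, ContinuousLinearMap.adjoint_adjoint]

end Blocks

section Propagation

variable {S Y F : Type*} [DecidableEq S] [PseudoMetricSpace Y]
  [NormedAddCommGroup F] [InnerProductSpace ℂ F] [CompleteSpace F]

/-- The matrix coefficients of `T` vanish between indices at distance more than `R`. -/
def BlockPropLE (pos : S → Y)
    (T : lp (fun _ : S => F) 2 →L[ℂ] lp (fun _ : S => F) 2) (R : ℝ) : Prop :=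
  ∀ y x ξ, R < dist (pos x) (pos y) → T (lp.single 2 y ξ) x = 0

/-- `T` becomes compact after restriction to bounded regions, on either side. -/
def BlockLocCompact (pos : S → Y)
    (T : lp (fun _ : S => F) 2 →L[ℂ] lp (fun _ : S => F) 2) : Prop :=
  ∀ s : Set S, Bornology.IsBounded (pos '' s) →
    IsCompactOperator (restrictProj F s * T) ∧ IsCompactOperator (T * restrictProj F s)

variable {pos : S → Y} {T T' : lp (fun _ : S => F) 2 →L[ℂ] lp (fun _ : S => F) 2} {R R' : ℝ}

namespace BlockPropLE

theorem apply_eq_zero (hT : BlockPropLE pos T R) {v : lp (fun _ : S => F) 2} {x : S}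
    (hv : ∀ y, dist (pos x) (pos y) ≤ R → v y = 0) : T v x = 0 := by
  refine lp_clm_apply_eq_zero fun y => ?_
  by_cases h : dist (pos x) (pos y) ≤ R
  · simp [hv y h]
  · exact hT y x _ (not_le.1 h)

theorem mul (hT : BlockPropLE pos T R) (hT' : BlockPropLE pos T' R') :
    BlockPropLE pos (T * T') (R + R') := fun y x ξ hxy =>
  hT.apply_eq_zero fun z hz => hT' y z ξ (by linarith [dist_triangle (pos x) (pos z) (pos y)])

theorem mono (hT : BlockPropLE pos T R) (h : R ≤ R') : BlockPropLE pos T R' :=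
  fun y x ξ hxy => hT y x ξ (h.trans_lt hxy)

theorem add (hT : BlockPropLE pos T R) (hT' : BlockPropLE pos T' R') :
    BlockPropLE pos (T + T') (max R R') := fun y x ξ hxy => by
  rw [max_lt_iff] at hxy
  change T (lp.single 2 y ξ) x + T' (lp.single 2 y ξ) x = 0
  rw [hT y x ξ hxy.1, hT' y x ξ hxy.2, add_zero]

theorem smul (c : ℂ) (hT : BlockPropLE pos T R) : BlockPropLE pos (c • T) R :=
  fun y x ξ hxy => by
    change c • T (lp.single 2 y ξ) x = 0
    rw [hT y x ξ hxy, smul_zero]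

theorem one : BlockPropLE pos (1 : lp (fun _ : S => F) 2 →L[ℂ] lp (fun _ : S => F) 2) 0 :=
  fun y x ξ hxy => lp.single_apply_ne _ _ _ fun h => by simp [h] at hxy

theorem star (hT : BlockPropLE pos T R) : BlockPropLE pos (star T) R := fun y x ξ hxy => by
  refine ext_inner_left (E := F) ℂ fun η => ?_
  refine (inner_lp_single_left x η _).symm.trans ?_
  rw [ContinuousLinearMap.star_eq_adjoint, ContinuousLinearMap.adjoint_inner_right,
    ← inner_conj_symm, inner_lp_single_left, hT x y η (by rwa [dist_comm]), inner_zero_right,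
    map_zero, inner_zero_right]

end BlockPropLE

namespace BlockLocCompact

theorem add (hT : BlockLocCompact pos T) (hT' : BlockLocCompact pos T') :
    BlockLocCompact pos (T + T') := fun s hs => by
  rw [mul_add, add_mul]
  exact ⟨(hT s hs).1.add (hT' s hs).1, (hT s hs).2.add (hT' s hs).2⟩

theorem smul (c : ℂ) (hT : BlockLocCompact pos T) : BlockLocCompact pos (c • T) :=
  fun s hs => by
    rw [mul_smul_comm, smul_mul_assoc]
    exact ⟨(hT s hs).1.smul c, (hT s hs).2.smul c⟩

theorem star (hT : BlockLocCompact pos T) : BlockLocCompact pos (star T) := fun s hs => by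
  have h1 := (hT s hs).1.adjoint
  have h2 := (hT s hs).2.adjoint
  rw [← ContinuousLinearMap.star_eq_adjoint, star_mul, ContinuousLinearMap.star_eq_adjoint
    (restrictProj F s), adjoint_restrictProj] at h1 h2
  exact ⟨h2, h1⟩

theorem mul_left (hT : BlockLocCompact pos T) (hT' : BlockPropLE pos T' R) :
    BlockLocCompact pos (T' * T) := fun s hs => by
  refine ⟨?_, ?_⟩
  · let s' : Set S := {y | ∃ x ∈ s, dist (pos x) (pos y) ≤ R}
    have hs' : Bornology.IsBounded (pos '' s') := by
      refine (hs.cthickening (δ := R)).subset ?_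
      rintro _ ⟨y, ⟨x, hx, hxy⟩, rfl⟩
      exact mem_cthickening_of_dist_le _ _ _ _ ⟨x, hx, rfl⟩ (by rwa [dist_comm])
    have h : restrictProj F s * T' = restrictProj F s * T' * restrictProj F s' := by
      ext v x
      change restrictProj F s (T' v) x = restrictProj F s (T' (restrictProj F s' v)) x
      by_cases hx : x ∈ s
      · rw [restrictProj_apply_of_mem _ hx, restrictProj_apply_of_mem _ hx, ← sub_eq_zero]
        have : T' (v - restrictProj F s' v) x = 0 := hT'.apply_eq_zero fun y hy => by
          change v y - restrictProj F s' v y = 0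
          rw [restrictProj_apply_of_mem v (s := s') ⟨x, hx, hy⟩, sub_self]
        rwa [map_sub] at this
      · rw [restrictProj_apply_of_notMem _ hx, restrictProj_apply_of_notMem _ hx]
    rw [← mul_assoc, h, mul_assoc]
    exact (hT s' hs').1.clm_comp (restrictProj F s * T')
  · rw [mul_assoc]
    exact (hT s hs).2.clm_comp _

end BlockLocCompact

end Propagation

section RoeCharacterization

variable {Y : Type*} [MetricSpace Y]

theorem exists_zeroAtInfty_bump [ProperSpace Y] (p : Y) (R : ℝ) {ε : ℝ} (hε : 0 < ε) :
    ∃ f : C₀(Y, ℂ), (∀ y, dist y p ≤ R → f y = 1) ∧ tsupport f ⊆ closedBall p (R + ε) := by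
  let g : Y → ℂ := fun y => ((max 0 (min 1 ((R + ε - dist y p) / ε)) : ℝ) : ℂ)
  have hg : Continuous g := by fun_prop
  have hsupp : tsupport g ⊆ closedBall p (R + ε) := by
    refine closure_minimal (fun y hy => ?_) isClosed_closedBall
    by_contra hyp
    rw [mem_closedBall, not_le] at hyp
    have : (R + ε - dist y p) / ε ≤ 0 := div_nonpos_of_nonpos_of_nonneg (by linarith) hε.le
    exact hy (by simp only [g]; rw [max_eq_left ((min_le_right _ _).trans this)]; simp)
  have hcomp : HasCompactSupport g := (isCompact_closedBall p (R + ε)).of_isClosed_subset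
    (isClosed_tsupport g) hsupp
  refine ⟨⟨⟨g, hg⟩, hcomp.is_zero_at_infty⟩, fun y hy => ?_, hsupp⟩
  have : 1 ≤ (R + ε - dist y p) / ε := by
    rw [le_div_iff₀ hε]
    linarith
  change g y = 1
  simp only [g]
  rw [min_eq_left this]
  simp

variable {S F : Type*} [DecidableEq S]
  [NormedAddCommGroup F] [InnerProductSpace ℂ F] [CompleteSpace F]
  {ρ : C₀(Y, ℂ) →⋆ₙₐ[ℂ] (lp (fun _ : S => F) 2 →L[ℂ] lp (fun _ : S => F) 2)} {pos : S → Y}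
  {T : lp (fun _ : S => F) 2 →L[ℂ] lp (fun _ : S => F) 2}

theorem BlockPropLE.of_hasPropLE [ProperSpace Y] (hρ : ∀ f v x, ρ f v x = f (pos x) • v x) {r : ℝ}
    (hT : HasPropLE ρ T r) : BlockPropLE pos T r := by
  intro y x ξ hxy
  have hε : 0 < (dist (pos x) (pos y) - r) / 2 := by linarith
  obtain ⟨f, hf1, hf⟩ := exists_zeroAtInfty_bump (pos x) 0 hε
  obtain ⟨g, hg1, hg⟩ := exists_zeroAtInfty_bump (pos y) 0 hε
  have h := hT f g fun a ha b hb => by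
    have h1 := mem_closedBall.1 (hf ha)
    have h2 := mem_closedBall.1 (hg hb)
    rw [dist_comm] at h1
    linarith [dist_triangle4 (pos x) a b (pos y)]
  have hy : ρ g (lp.single 2 y ξ) = lp.single 2 y ξ := by
    ext z : 2
    rw [hρ]
    by_cases hz : z = y
    · rw [hz, hg1 _ (by simp), one_smul]
    · rw [lp.single_apply_ne _ _ _ hz, smul_zero]
  have h' : ρ f (T (ρ g (lp.single 2 y ξ))) x = 0 := by
    change (ρ f * T * ρ g) (lp.single 2 y ξ) x = 0
    rw [h]
    rfl
  rwa [hy, hρ, hf1 _ (by simp), one_smul] at h'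

theorem BlockPropLE.hasPropLE (hρ : ∀ f v x, ρ f v x = f (pos x) • v x) {R r : ℝ}
    (hT : BlockPropLE pos T R) (hr : R < r) : HasPropLE ρ T r := by
  intro f g hfg
  ext v x
  change ρ f (T (ρ g v)) x = 0
  rw [hρ]
  by_cases hx : f (pos x) = 0
  · rw [hx, zero_smul]
  · rw [hT.apply_eq_zero fun y hy => ?_, smul_zero]
    rw [hρ]
    by_cases hgy : g (pos y) = 0
    · rw [hgy, zero_smul]
    · exact absurd (hfg _ (subset_tsupport _ hx) _ (subset_tsupport _ hgy)) (by linarith)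

theorem BlockLocCompact.of_isLocCompactOp [ProperSpace Y]
    (hρ : ∀ f v x, ρ f v x = f (pos x) • v x)
    (hT : IsLocCompactOp ρ T) : BlockLocCompact pos T := by
  intro s hs
  rcases s.eq_empty_or_nonempty with rfl | ⟨p, hp⟩
  · have : restrictProj F (∅ : Set S) = 0 := by
      ext v x
      change restrictProj F ∅ v x = 0
      rw [restrictProj_apply_of_notMem v (Set.notMem_empty x)]
    rw [this, zero_mul, mul_zero]
    exact ⟨isCompactOperator_zero, isCompactOperator_zero⟩
  obtain ⟨C, hC⟩ := isBounded_iff.1 hs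
  obtain ⟨f, hf1, -⟩ := exists_zeroAtInfty_bump (pos p) C one_pos
  have hfs : ∀ x ∈ s, f (pos x) = 1 := fun x hx => hf1 _ (hC ⟨x, hx, rfl⟩ ⟨p, hp, rfl⟩)
  have h1 : restrictProj F s * ρ f = restrictProj F s := by
    ext v x
    change restrictProj F s (ρ f v) x = restrictProj F s v x
    by_cases hx : x ∈ s
    · rw [restrictProj_apply_of_mem _ hx, restrictProj_apply_of_mem _ hx, hρ, hfs x hx, one_smul]
    · rw [restrictProj_apply_of_notMem _ hx, restrictProj_apply_of_notMem _ hx]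
  have h2 : ρ f * restrictProj F s = restrictProj F s := by
    ext v x
    change ρ f (restrictProj F s v) x = restrictProj F s v x
    rw [hρ]
    by_cases hx : x ∈ s
    · rw [hfs x hx, one_smul]
    · rw [restrictProj_apply_of_notMem _ hx, smul_zero]
  constructor
  · rw [← h1, mul_assoc]
    exact (hT f).1.clm_comp (restrictProj F s)
  · rw [← h2, ← mul_assoc]
    exact (hT f).2.comp_clm _

theorem BlockLocCompact.isLocCompactOp (hρ : ∀ f v x, ρ f v x = f (pos x) • v x)
    (hT : BlockLocCompact pos T) : IsLocCompactOp ρ T := by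
  intro f
  have hbdd : ∀ ε > 0, Bornology.IsBounded (pos '' {x | ε ≤ ‖f (pos x)‖}) := by
    intro ε hε
    obtain ⟨t, ht, hts⟩ := mem_cocompact.1
      ((Metric.tendsto_nhds.1 (ZeroAtInftyContinuousMapClass.zero_at_infty f)) ε hε)
    refine ht.isBounded.subset ?_
    rintro _ ⟨x, hx, rfl⟩
    by_contra hxt
    have : dist (f (pos x)) 0 < ε := hts hxt
    rw [dist_zero_right] at this
    exact absurd hx (not_le.2 this)
  have hcomm : ∀ s, ρ f * restrictProj F s = restrictProj F s * ρ f := by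
    intro s
    ext v x
    change ρ f (restrictProj F s v) x = restrictProj F s (ρ f v) x
    rw [hρ]
    by_cases hx : x ∈ s
    · rw [restrictProj_apply_of_mem _ hx, restrictProj_apply_of_mem _ hx, hρ]
    · rw [restrictProj_apply_of_notMem _ hx, restrictProj_apply_of_notMem _ hx, smul_zero]
  have happrox : ∀ ε > 0,
      ‖ρ f - ρ f * restrictProj F {x | ε ≤ ‖f (pos x)‖}‖ ≤ ε := by
    intro ε hε
    refine ContinuousLinearMap.opNorm_le_bound _ hε.le fun v => ?_
    have : ‖(ε : ℂ) • v‖ = ε * ‖v‖ := by rw [norm_smul]; simp [abs_of_pos hε]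
    rw [← this]
    refine lp.norm_mono (by norm_num) fun x => ?_
    change ‖ρ f v x - ρ f (restrictProj F _ v) x‖ ≤ ‖(ε : ℂ) • v x‖
    rw [hρ, hρ]
    by_cases hx : ε ≤ ‖f (pos x)‖
    · rw [restrictProj_apply_of_mem v (s := {x | ε ≤ ‖f (pos x)‖}) hx, sub_self, norm_zero]
      exact norm_nonneg _
    · rw [restrictProj_apply_of_notMem v (s := {x | ε ≤ ‖f (pos x)‖}) hx, smul_zero, sub_zero,
        norm_smul, norm_smul]
      refine mul_le_mul_of_nonneg_right ?_ (norm_nonneg _)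
      simpa [abs_of_pos hε] using (not_le.1 hx).le
  have hlim : Tendsto (fun n : ℕ => ρ f * restrictProj F {x | 1 / ((n : ℝ) + 1) ≤ ‖f (pos x)‖})
      atTop (nhds (ρ f)) := by
    refine tendsto_iff_norm_sub_tendsto_zero.2 (squeeze_zero (fun _ => norm_nonneg _)
      (fun n => ?_) tendsto_one_div_add_atTop_nhds_zero_nat)
    rw [norm_sub_rev]
    exact happrox _ Nat.one_div_pos_of_nat
  constructor
  · refine isCompactOperator_of_tendsto (hlim.mul_const T) (Eventually.of_forall fun n => ?_)
    rw [mul_assoc]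
    exact (hT _ (hbdd _ Nat.one_div_pos_of_nat)).1.clm_comp _
  · refine isCompactOperator_of_tendsto (hlim.const_mul T) (Eventually.of_forall fun n => ?_)
    rw [hcomm, ← mul_assoc]
    exact (hT _ (hbdd _ Nat.one_div_pos_of_nat)).2.comp_clm _

theorem mem_roeAlgSet_iff [ProperSpace Y] {Γ : Type*} [Group Γ]
    {u : Γ →* unitary (lp (fun _ : S => F) 2 →L[ℂ] lp (fun _ : S => F) 2)}
    (hρ : ∀ f v x, ρ f v x = f (pos x) • v x) :
    T ∈ RoeAlgSet ρ u ↔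
      IsEquivariantOp u T ∧ BlockLocCompact pos T ∧ ∃ R, BlockPropLE pos T R := by
  refine and_congr_right fun _ => and_congr ⟨.of_isLocCompactOp hρ, fun h => h.isLocCompactOp hρ⟩
    ⟨fun ⟨r, _, h⟩ => ⟨r, .of_hasPropLE hρ h⟩, fun ⟨R, h⟩ => ⟨|R| + 1, by positivity, ?_⟩⟩
  exact h.hasPropLE hρ (by linarith [le_abs_self R])

end RoeCharacterization

section EquivariantOperators

namespace IsEquivariantOp

variable {Γ H : Type*} [Group Γ] [NormedAddCommGroup H] [InnerProductSpace ℂ H] [CompleteSpace H]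
  {u : Γ →* unitary (H →L[ℂ] H)} {T T' : H →L[ℂ] H}

theorem add (hT : IsEquivariantOp u T) (hT' : IsEquivariantOp u T') : IsEquivariantOp u (T + T') :=
  fun γ => by rw [mul_add, add_mul, hT γ, hT' γ]

theorem smul (c : ℂ) (hT : IsEquivariantOp u T) : IsEquivariantOp u (c • T) :=
  fun γ => by rw [mul_smul_comm, smul_mul_assoc, hT γ]

theorem mul (hT : IsEquivariantOp u T) (hT' : IsEquivariantOp u T') : IsEquivariantOp u (T * T') :=
  fun γ => by rw [← mul_assoc, hT γ, mul_assoc, hT' γ, mul_assoc]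

theorem star (hT : IsEquivariantOp u T) : IsEquivariantOp u (star T) := fun γ => by
  have h : Star.star (u γ⁻¹ : H →L[ℂ] H) = u γ := by
    rw [← Unitary.coe_star, Unitary.star_eq_inv, map_inv, inv_inv]
  have := congrArg Star.star (hT γ⁻¹)
  rw [star_mul, star_mul, h] at this
  exact this.symm

end IsEquivariantOp

variable {Γ S Y F : Type*} [Group Γ] [DecidableEq S] [PseudoMetricSpace Y]
  [NormedAddCommGroup F] [InnerProductSpace ℂ F] [CompleteSpace F]

theorem isEquivariantOp_of_single [MulAction Γ S]
    {u : Γ →* unitary (lp (fun _ : S => F) 2 →L[ℂ] lp (fun _ : S => F) 2)}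
    (hu : ∀ γ x ξ, (u γ : lp (fun _ : S => F) 2 →L[ℂ] lp (fun _ : S => F) 2) (lp.single 2 x ξ)
      = lp.single 2 (γ • x) ξ)
    {T : lp (fun _ : S => F) 2 →L[ℂ] lp (fun _ : S => F) 2}
    (hT : ∀ γ x ξ, (u γ : lp (fun _ : S => F) 2 →L[ℂ] lp (fun _ : S => F) 2)
      (T (lp.single 2 x ξ)) = T (lp.single 2 (γ • x) ξ)) : IsEquivariantOp u T := fun γ =>
  lp_clm_ext fun x ξ => by
    rw [mul_apply_eq_comp, mul_apply_eq_comp, hu, hT]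

variable (u : Γ →* unitary (lp (fun _ : S => F) 2 →L[ℂ] lp (fun _ : S => F) 2)) (pos : S → Y)

/-- The equivariant operators of finite propagation. -/
def equivariantFinProp : StarSubalgebra ℂ (lp (fun _ : S => F) 2 →L[ℂ] lp (fun _ : S => F) 2) where
  carrier := {T | IsEquivariantOp u T ∧ ∃ R, BlockPropLE pos T R}
  add_mem' := fun ⟨h, _, hR⟩ ⟨h', _, hR'⟩ => ⟨h.add h', _, hR.add hR'⟩
  mul_mem' := fun ⟨h, _, hR⟩ ⟨h', _, hR'⟩ => ⟨h.mul h', _, hR.mul hR'⟩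
  star_mem' := fun ⟨h, _, hR⟩ => ⟨h.star, _, hR.star⟩
  algebraMap_mem' c := by
    rw [Algebra.algebraMap_eq_smul_one]
    exact ⟨.smul c fun γ => by rw [mul_one, one_mul], _, BlockPropLE.one.smul c⟩

/-- The equivariant Roe algebra, described by matrix coefficients. -/
def equivariantRoe : Set (lp (fun _ : S => F) 2 →L[ℂ] lp (fun _ : S => F) 2) :=
  {T | IsEquivariantOp u T ∧ BlockLocCompact pos T ∧ ∃ R, BlockPropLE pos T R}

variable {u pos}

theorem star_mem_equivariantRoe {T : lp (fun _ : S => F) 2 →L[ℂ] lp (fun _ : S => F) 2}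
    (hT : T ∈ equivariantRoe u pos) : star T ∈ equivariantRoe u pos :=
  ⟨hT.1.star, hT.2.1.star, hT.2.2.imp fun _ h => h.star⟩

theorem isMultiplierPair_equivariantRoe :
    IsMultiplierPair (equivariantRoe u pos) (equivariantFinProp u pos) where
  add_mem := fun _ ⟨h, hc, _, hR⟩ _ ⟨h', hc', _, hR'⟩ => ⟨h.add h', hc.add hc', _, hR.add hR'⟩
  smul_mem := fun c _ ⟨h, hc, _, hR⟩ => ⟨h.smul c, hc.smul c, _, hR.smul c⟩
  star_mem := fun _ h => star_mem_equivariantRoe h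
  subset := fun _ h => ⟨h.1, h.2.2⟩
  star_mem_multiplier := fun _ h => star_mem h
  mul_mem := fun _ ⟨h, _, hR⟩ _ ⟨h', hc', _, hR'⟩ =>
    ⟨h.mul h', hc'.mul_left hR, _, hR.mul hR'⟩

end EquivariantOperators

section ImplementedMultipliers

variable {Γ S Y F : Type*} [Group Γ] [DecidableEq S] [PseudoMetricSpace Y]
  [NormedAddCommGroup F] [InnerProductSpace ℂ F] [CompleteSpace F]
  {u : Γ →* unitary (lp (fun _ : S => F) 2 →L[ℂ] lp (fun _ : S => F) 2)} {pos : S → Y}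
  {H₀ : Type*} [NormedAddCommGroup H₀] [InnerProductSpace ℂ H₀] [CompleteSpace H₀]
  {σ : (lp (fun _ : S => F) 2 →L[ℂ] lp (fun _ : S => F) 2) → (H₀ →L[ℂ] H₀)}

/-- The equivariant finite propagation operators that act in the representation `σ` of the Roe
algebra. -/
def implementedMultipliers (pos : S → Y) (hσ : IsStarRepOn (equivariantRoe u pos) σ) :
    Submodule ℂ (lp (fun _ : S => F) 2 →L[ℂ] lp (fun _ : S => F) 2) where
  carrier := {b | b ∈ equivariantFinProp u pos ∧ ∃ B, Implements (equivariantRoe u pos) σ b B}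
  add_mem' := fun ⟨hb, _, h⟩ ⟨hb', _, h'⟩ =>
    ⟨add_mem hb hb', _, h.add isMultiplierPair_equivariantRoe hσ hb hb' h'⟩
  zero_mem' := ⟨zero_mem _, 0, fun a ha v => by
    have := hσ.2.1 0 a ha
    rw [zero_smul, zero_smul] at this
    rw [zero_mul, this]
    rfl⟩
  smul_mem' := fun c _ ⟨hb, _, h⟩ =>
    ⟨(equivariantFinProp u pos).smul_mem hb c, _, h.smul isMultiplierPair_equivariantRoe hσ hb c⟩

variable [MulAction Γ S] [MulAction Γ Y] [IsIsometricSMul Γ Y] [DecidableEq Γ]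

/-- Any operator on the fibre, shifted along a free orbit, acts in every nondegenerate
representation of the equivariant Roe algebra. -/
theorem exists_orbitShift
    (hu : ∀ γ x ξ, (u γ : lp (fun _ : S => F) 2 →L[ℂ] lp (fun _ : S => F) 2) (lp.single 2 x ξ)
      = lp.single 2 (γ • x) ξ)
    (hpos : ∀ (γ : Γ) x, pos (γ • x) = γ • pos x)
    (hσ : IsStarRepOn (equivariantRoe u pos) σ) (hnd : IsNondegRepOn (equivariantRoe u pos) σ)
    {d₀ : S} (hd₀ : (fun η : Γ => η • d₀).Injective) (γ : Γ) (A : F →L[ℂ] F) :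
    ∃ b ∈ implementedMultipliers pos hσ,
      (∀ (η : Γ) ξ, b (lp.single 2 (η • d₀) ξ) = lp.single 2 ((η * γ⁻¹) • d₀) (A ξ)) ∧
      ∀ y, (∀ η : Γ, η • d₀ ≠ y) → ∀ ξ, b (lp.single 2 y ξ) = 0 := by
  have hmem : ∀ (b : lp (fun _ : S => F) 2 →L[ℂ] lp (fun _ : S => F) 2) (γ : Γ) (A : F →L[ℂ] F),
      (∀ (η : Γ) ξ, b (lp.single 2 (η • d₀) ξ) = lp.single 2 ((η * γ⁻¹) • d₀) (A ξ)) →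
      (∀ y, (∀ η : Γ, η • d₀ ≠ y) → ∀ ξ, b (lp.single 2 y ξ) = 0) →
      b ∈ equivariantFinProp u pos := by
    intro b γ A h1 h2
    refine ⟨isEquivariantOp_of_single hu fun κ y ξ => ?_, dist (γ⁻¹ • pos d₀) (pos d₀),
      fun y x ξ hxy => ?_⟩
    · by_cases hy : ∃ η : Γ, η • d₀ = y
      · obtain ⟨η, rfl⟩ := hy
        rw [h1, hu, smul_smul, smul_smul, h1, mul_assoc]
      · push Not at hy
        rw [h2 y hy, h2, map_zero]
        intro η hη
        exact hy (κ⁻¹ * η) (by rw [mul_smul, hη, inv_smul_smul])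
    · by_cases hy : ∃ η : Γ, η • d₀ = y
      · obtain ⟨η, rfl⟩ := hy
        rw [h1]
        refine lp.single_apply_ne _ _ _ fun hx => ?_
        rw [hx, hpos, hpos, mul_smul, dist_smul] at hxy
        exact lt_irrefl _ hxy
      · push Not at hy
        rw [h2 y hy]
        rfl
  have hA : A ∈ Submodule.span ℂ (unitary (F →L[ℂ] F) : Set (F →L[ℂ] F)) := by
    rw [CStarAlgebra.span_unitary]
    trivial
  induction hA using Submodule.span_induction with
  | zero => exact ⟨0, zero_mem _, fun η ξ => by simp [lp.single_zero], fun y _ ξ => rfl⟩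
  | add A A' _ _ h h' =>
    obtain ⟨b, hb, hb1, hb2⟩ := h
    obtain ⟨b', hb', hb1', hb2'⟩ := h'
    refine ⟨b + b', add_mem hb hb', fun η ξ => ?_, fun y hy ξ => ?_⟩
    · rw [add_apply, hb1, hb1', add_apply, lp.single_add]
    · rw [add_apply, hb2 y hy, hb2' y hy, add_zero]
  | smul c A _ h =>
    obtain ⟨b, hb, hb1, hb2⟩ := h
    refine ⟨c • b, Submodule.smul_mem _ c hb, fun η ξ => ?_, fun y hy ξ => ?_⟩
    · rw [smul_apply, hb1, smul_apply, lp.single_smul]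
    · rw [smul_apply, hb2 y hy, smul_zero]
  | mem A hA =>
    let E := extendIsom F (fun η : Γ => η • d₀) hd₀
    have hγ : (fun η : Γ => (η * γ⁻¹) • d₀).Injective := fun η κ h => mul_right_cancel (hd₀ h)
    let U : F →ₗᵢ[ℂ] F := ⟨A.toLinearMap, A.norm_map_of_mem_unitary hA⟩
    let E' : lp (fun _ : Γ => F) 2 →ₗᵢ[ℂ] lp (fun _ : S => F) 2 :=
      blockIsom (fun η : Γ => (η * γ⁻¹) • d₀) (fun _ => U) fun _ _ hab h => (hab (hγ h)).elim
    let P := E.toContinuousLinearMap ∘L ContinuousLinearMap.adjoint E.toContinuousLinearMap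
    let b := E'.toContinuousLinearMap ∘L ContinuousLinearMap.adjoint E.toContinuousLinearMap
    have hP1 : ∀ (η : Γ) ξ, P (lp.single 2 (η • d₀) ξ) = lp.single 2 (η • d₀) ξ := fun η ξ => by
      change E (ContinuousLinearMap.adjoint E.toContinuousLinearMap (lp.single 2 (η • d₀) ξ)) = _
      rw [extendIsom_adjoint_single (hf := hd₀) η, extendIsom_single]
    have hP2 : ∀ y, (∀ η : Γ, η • d₀ ≠ y) → ∀ ξ, P (lp.single 2 y ξ) = 0 := fun y hy ξ => by
      change E (ContinuousLinearMap.adjoint E.toContinuousLinearMap (lp.single 2 y ξ)) = _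
      rw [extendIsom_adjoint_single_of_notMem (hf := hd₀) hy, map_zero]
    have hb1 : ∀ (η : Γ) ξ, b (lp.single 2 (η • d₀) ξ) = lp.single 2 ((η * γ⁻¹) • d₀) (A ξ) := by
      intro η ξ
      change E' (ContinuousLinearMap.adjoint E.toContinuousLinearMap (lp.single 2 (η • d₀) ξ)) = _
      rw [extendIsom_adjoint_single (hf := hd₀) η, blockIsom_single]
      rfl
    have hb2 : ∀ y, (∀ η : Γ, η • d₀ ≠ y) → ∀ ξ, b (lp.single 2 y ξ) = 0 := fun y hy ξ => by
      change E' (ContinuousLinearMap.adjoint E.toContinuousLinearMap (lp.single 2 y ξ)) = _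
      rw [extendIsom_adjoint_single_of_notMem (hf := hd₀) hy, map_zero]
    have hP : P ∈ equivariantFinProp u pos := hmem P 1 1 (by simpa using hP1) hP2
    have hb : b ∈ equivariantFinProp u pos := hmem b γ A hb1 hb2
    have hE : ContinuousLinearMap.adjoint E.toContinuousLinearMap ∘L E.toContinuousLinearMap = 1 :=
      E.adjoint_comp_self
    have hE' : ContinuousLinearMap.adjoint E'.toContinuousLinearMap ∘L E'.toContinuousLinearMap
        = 1 := E'.adjoint_comp_self
    have hbb : star b * b = P := by
      rw [ContinuousLinearMap.star_eq_adjoint, ContinuousLinearMap.adjoint_comp,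
        ContinuousLinearMap.adjoint_adjoint]
      ext1 v
      exact congrArg E (congrArg (fun T => T (ContinuousLinearMap.adjoint
        E.toContinuousLinearMap v)) hE')
    have hPstar : star P = P := by
      rw [ContinuousLinearMap.star_eq_adjoint, ContinuousLinearMap.adjoint_comp,
        ContinuousLinearMap.adjoint_adjoint]
    have hPP : P * P = P := by
      ext1 v
      exact congrArg E (congrArg (fun T => T (ContinuousLinearMap.adjoint
        E.toContinuousLinearMap v)) hE)
    refine ⟨b, ⟨hb, Implements.exists_of_star_mul_add isMultiplierPair_equivariantRoe hσ hnd hb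
      (sub_mem (one_mem _) hP) ?_⟩, hb1, hb2⟩
    rw [hbb, star_sub, star_one, hPstar, mul_sub, mul_one, sub_mul, one_mul, hPP, sub_self,
      sub_zero, add_sub_cancel]

end ImplementedMultipliers

section Collapse

variable {Γ SX SZ Y F : Type*} [Group Γ] [DecidableEq Γ] [DecidableEq SX] [DecidableEq SZ]
  [PseudoMetricSpace Y] [NormedAddCommGroup F] [InnerProductSpace ℂ F] [CompleteSpace F]
  [MulAction Γ SX] [MulAction Γ SZ] [MulAction Γ Y] [IsIsometricSMul Γ Y]
  {uX : Γ →* unitary (lp (fun _ : SX => F) 2 →L[ℂ] lp (fun _ : SX => F) 2)} {posX : SX → Y}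
  {uZ : Γ →* unitary (lp (fun _ : SZ => F) 2 →L[ℂ] lp (fun _ : SZ => F) 2)} {posZ : SZ → Y}

/-- The isometry moving each fundamental domain onto one orbit point, using the orthogonal copies
`W` of the fibre to keep different points apart. Here `g x` is the translate of the fundamental
domain that contains `x`. -/
def collapse (g : SX → Γ) (W : SX → F →ₗᵢ[ℂ] F)
    (hW : ∀ x y, x ≠ y → ∀ ξ η, inner ℂ (W x ξ) (W y η) = 0) (d₀ : SZ)
    (hd₀ : (fun η : Γ => η • d₀).Injective) :
    lp (fun _ : SX => F) 2 →ₗᵢ[ℂ] lp (fun _ : SZ => F) 2 :=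
  blockIsom (fun x => g x • d₀) (fun x => W ((g x)⁻¹ • x)) fun a b hab h => by
    have h' : g a = g b := hd₀ h
    exact hW _ _ fun hc => hab (by rwa [h', smul_left_cancel_iff] at hc)

variable {g : SX → Γ} {W : SX → F →ₗᵢ[ℂ] F}
  {hW : ∀ x y, x ≠ y → ∀ ξ η, inner ℂ (W x ξ) (W y η) = 0} {d₀ : SZ}
  {hd₀ : (fun η : Γ => η • d₀).Injective}

theorem collapse_apply_eq_zero {v : lp (fun _ : SX => F) 2} {b : SZ}
    (hv : ∀ x, g x • d₀ = b → v x = 0) : collapse g W hW d₀ hd₀ v b = 0 :=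
  blockIsom_apply_eq_zero hv

theorem collapse_equivariant
    (huX : ∀ γ x ξ, (uX γ : lp (fun _ : SX => F) 2 →L[ℂ] lp (fun _ : SX => F) 2)
      (lp.single 2 x ξ) = lp.single 2 (γ • x) ξ)
    (huZ : ∀ γ x ξ, (uZ γ : lp (fun _ : SZ => F) 2 →L[ℂ] lp (fun _ : SZ => F) 2)
      (lp.single 2 x ξ) = lp.single 2 (γ • x) ξ)
    (hg : ∀ γ x, g (γ • x) = γ * g x) (γ : Γ) :
    (collapse g W hW d₀ hd₀).toContinuousLinearMap ∘L
        (uX γ : lp (fun _ : SX => F) 2 →L[ℂ] lp (fun _ : SX => F) 2)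
      = (uZ γ : lp (fun _ : SZ => F) 2 →L[ℂ] lp (fun _ : SZ => F) 2) ∘L
        (collapse g W hW d₀ hd₀).toContinuousLinearMap := by
  refine lp_clm_ext fun x ξ => ?_
  change collapse g W hW d₀ hd₀ ((uX γ : lp (fun _ : SX => F) 2 →L[ℂ] lp (fun _ : SX => F) 2)
    (lp.single 2 x ξ)) = (uZ γ : lp (fun _ : SZ => F) 2 →L[ℂ] lp (fun _ : SZ => F) 2)
      (collapse g W hW d₀ hd₀ (lp.single 2 x ξ))
  rw [huX, collapse, blockIsom_single, blockIsom_single, huZ, smul_smul, hg, mul_inv_rev, smul_smul,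
    inv_mul_cancel_right]

theorem adjoint_intertwines {HX HZ : Type*} [NormedAddCommGroup HX] [InnerProductSpace ℂ HX]
    [CompleteSpace HX] [NormedAddCommGroup HZ] [InnerProductSpace ℂ HZ] [CompleteSpace HZ]
    {u : Γ →* unitary (HX →L[ℂ] HX)} {v : Γ →* unitary (HZ →L[ℂ] HZ)} {Φ : HX →L[ℂ] HZ}
    (h : ∀ γ, Φ ∘L (u γ : HX →L[ℂ] HX) = (v γ : HZ →L[ℂ] HZ) ∘L Φ) (γ : Γ) :
    ContinuousLinearMap.adjoint Φ ∘L (v γ : HZ →L[ℂ] HZ)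
      = (u γ : HX →L[ℂ] HX) ∘L ContinuousLinearMap.adjoint Φ := by
  have hu : ContinuousLinearMap.adjoint (u γ⁻¹ : HX →L[ℂ] HX) = u γ := by
    rw [← ContinuousLinearMap.star_eq_adjoint, ← Unitary.coe_star, Unitary.star_eq_inv, map_inv,
      inv_inv]
  have hv : ContinuousLinearMap.adjoint (v γ⁻¹ : HZ →L[ℂ] HZ) = v γ := by
    rw [← ContinuousLinearMap.star_eq_adjoint, ← Unitary.coe_star, Unitary.star_eq_inv, map_inv,
      inv_inv]
  have := congrArg ContinuousLinearMap.adjoint (h γ⁻¹)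
  rw [ContinuousLinearMap.adjoint_comp, ContinuousLinearMap.adjoint_comp, hu, hv] at this
  exact this.symm

theorem isEquivariantOp_conj {HX HZ : Type*} [NormedAddCommGroup HX] [InnerProductSpace ℂ HX]
    [CompleteSpace HX] [NormedAddCommGroup HZ] [InnerProductSpace ℂ HZ] [CompleteSpace HZ]
    {u : Γ →* unitary (HX →L[ℂ] HX)} {v : Γ →* unitary (HZ →L[ℂ] HZ)} {Φ : HX →L[ℂ] HZ}
    (h : ∀ γ, Φ ∘L (u γ : HX →L[ℂ] HX) = (v γ : HZ →L[ℂ] HZ) ∘L Φ) {T : HX →L[ℂ] HX}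
    (hT : IsEquivariantOp u T) :
    IsEquivariantOp v (Φ ∘L T ∘L ContinuousLinearMap.adjoint Φ) := fun γ => by
  ext1 x
  change (v γ : HZ →L[ℂ] HZ) (Φ (T (ContinuousLinearMap.adjoint Φ x)))
    = Φ (T (ContinuousLinearMap.adjoint Φ ((v γ : HZ →L[ℂ] HZ) x)))
  have h1 := fun y => DFunLike.congr_fun (h γ) y
  have h2 := fun y => DFunLike.congr_fun (adjoint_intertwines h γ) y
  have h3 := fun y => DFunLike.congr_fun (hT γ) y
  simp only [ContinuousLinearMap.comp_apply, mul_apply_eq_comp] at h1 h2 h3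
  rw [h2, ← h3, h1]

variable {H₀ : Type*} [NormedAddCommGroup H₀] [InnerProductSpace ℂ H₀] [CompleteSpace H₀]
  {σ : (lp (fun _ : SZ => F) 2 →L[ℂ] lp (fun _ : SZ => F) 2) → (H₀ →L[ℂ] H₀)}

theorem collapse_conj_mem_implementedMultipliers
    (huX : ∀ γ x ξ, (uX γ : lp (fun _ : SX => F) 2 →L[ℂ] lp (fun _ : SX => F) 2)
      (lp.single 2 x ξ) = lp.single 2 (γ • x) ξ)
    (huZ : ∀ γ x ξ, (uZ γ : lp (fun _ : SZ => F) 2 →L[ℂ] lp (fun _ : SZ => F) 2)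
      (lp.single 2 x ξ) = lp.single 2 (γ • x) ξ)
    (hg : ∀ γ x, g (γ • x) = γ * g x)
    (hcover : ∀ R, ∃ s : Finset Γ, ∀ x y, dist (posX x) (posX y) ≤ R → (g x)⁻¹ * g y ∈ s)
    (hpos : ∀ (γ : Γ) x, posZ (γ • x) = γ • posZ x)
    (hσ : IsStarRepOn (equivariantRoe uZ posZ) σ) (hnd : IsNondegRepOn (equivariantRoe uZ posZ) σ)
    {T : lp (fun _ : SX => F) 2 →L[ℂ] lp (fun _ : SX => F) 2}
    (hT : IsEquivariantOp uX T) {R : ℝ} (hR : BlockPropLE posX T R) :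
    (collapse g W hW d₀ hd₀).toContinuousLinearMap ∘L T ∘L
        ContinuousLinearMap.adjoint (collapse g W hW d₀ hd₀).toContinuousLinearMap
      ∈ implementedMultipliers posZ hσ := by
  set Φ := collapse g W hW d₀ hd₀ with hΦ
  set m := Φ.toContinuousLinearMap ∘L T ∘L ContinuousLinearMap.adjoint Φ.toContinuousLinearMap
    with hm
  have hmu : IsEquivariantOp uZ m :=
    isEquivariantOp_conj (fun γ => collapse_equivariant huX huZ hg γ) hT
  let A : Γ → F →L[ℂ] F := fun γ => lp.evalCLM ℂ (fun _ : SZ => F) 2 d₀ ∘L m ∘L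
    lp.singleContinuousLinearMap ℂ (fun _ : SZ => F) 2 (γ • d₀)
  have hA : ∀ γ ξ, A γ ξ = m (lp.single 2 (γ • d₀) ξ) d₀ := fun _ _ => rfl
  obtain ⟨s, hs⟩ := hcover R
  have hA0 : ∀ γ ∉ s, A γ = 0 := by
    intro γ hγ
    ext1 ξ
    rw [hA]
    refine collapse_apply_eq_zero (hW := hW) (hd₀ := hd₀) fun x hx => ?_
    have hgx : g x = 1 := hd₀ (by simpa using hx)
    refine hR.apply_eq_zero fun y hy => ?_
    refine (blockIsom_adjoint_apply _ y).trans ?_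
    rw [lp.single_apply_ne, map_zero]
    intro h
    have hgy : g y = γ := hd₀ h
    have := hs x y hy
    rw [hgx, hgy, inv_one, one_mul] at this
    exact hγ this
  have hmA : ∀ η κ ξ, m (lp.single 2 (η • d₀) ξ) (κ • d₀) = A (κ⁻¹ * η) ξ := by
    intro η κ ξ
    have h1 := DFunLike.congr_fun (hmu κ) (lp.single 2 ((κ⁻¹ * η) • d₀) ξ)
    rw [mul_apply_eq_comp, mul_apply_eq_comp, huZ, smul_smul, mul_inv_cancel_left] at h1
    rw [hA, ← h1]
    generalize m (lp.single 2 ((κ⁻¹ * η) • d₀) ξ) = v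
    refine ext_inner_left (E := F) ℂ fun ζ => ?_
    rw [← inner_lp_single_left, ← huZ κ d₀ ζ, ← inner_lp_single_left]
    exact ContinuousLinearMap.inner_map_map_of_mem_unitary (uZ κ).2 _ _
  choose b hb hb1 hb2 using fun γ => exists_orbitShift huZ hpos hσ hnd hd₀ γ (A γ)
  have hsum : m = ∑ γ ∈ s, b γ := by
    refine lp_clm_ext fun y ξ => ?_
    rw [sum_apply]
    by_cases hy : ∃ η : Γ, η • d₀ = y
    · obtain ⟨η, rfl⟩ := hy
      simp only [hb1]
      ext x : 2
      rw [lp.coeFn_sum, Finset.sum_apply]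
      by_cases hx : ∃ κ : Γ, κ • d₀ = x
      · obtain ⟨κ, rfl⟩ := hx
        rw [hmA, Finset.sum_eq_single (κ⁻¹ * η)]
        · rw [mul_inv_rev, inv_inv, mul_inv_cancel_left, lp.single_apply_self]
        · intro γ _ hγ
          refine lp.single_apply_ne _ _ _ fun h => hγ ?_
          have h' : κ = η * γ⁻¹ := hd₀ h
          rw [h']
          group
        · intro h
          rw [hA0 _ h, zero_apply, lp.single_zero]
          rfl
      · push Not at hx
        rw [Finset.sum_eq_zero fun γ _ => lp.single_apply_ne _ _ _ (hx (η * γ⁻¹)).symm]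
        exact collapse_apply_eq_zero (hW := hW) (hd₀ := hd₀) fun a ha => (hx _ ha).elim
    · push Not at hy
      rw [Finset.sum_eq_zero fun γ _ => hb2 γ y hy ξ]
      change Φ (T (ContinuousLinearMap.adjoint Φ.toContinuousLinearMap (lp.single 2 y ξ))) = 0
      have : ContinuousLinearMap.adjoint Φ.toContinuousLinearMap (lp.single 2 y ξ) = 0 :=
        blockIsom_adjoint_single_of_notMem (fun x => hy (g x)) ξ
      rw [this, map_zero, map_zero]
  rw [hsum]
  exact sum_mem fun γ _ => hb γ

end Collapse

section Compression

variable {HX HZ H₀ : Type*} [NormedAddCommGroup HX] [InnerProductSpace ℂ HX] [CompleteSpace HX]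
  [NormedAddCommGroup HZ] [InnerProductSpace ℂ HZ] [CompleteSpace HZ]
  [NormedAddCommGroup H₀] [InnerProductSpace ℂ H₀] [CompleteSpace H₀]
  {A M : Set (HZ →L[ℂ] HZ)} {R : Set (HX →L[ℂ] HX)} {σ : (HZ →L[ℂ] HZ) → (H₀ →L[ℂ] H₀)}

/-- If an isometry `Φ` compresses the algebra `R` to multipliers of `A`, and `ι` is an isometry for
which `Φ ∘ ι` is itself a multiplier, then a representation of `A` induces one of `R`, extending the
original one up to an isometry. -/
theorem exists_starRep_of_compression (hA : IsMultiplierPair A M) (hσ : IsStarRepOn A σ)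
    (hnd : IsNondegRepOn A σ) (Φ : HX →ₗᵢ[ℂ] HZ) (ι : HZ →ₗᵢ[ℂ] HX)
    (hΦ : ∀ T ∈ R, Φ.toContinuousLinearMap ∘L T ∘L
        ContinuousLinearMap.adjoint Φ.toContinuousLinearMap ∈ M ∧
      ∃ S, Implements A σ (Φ.toContinuousLinearMap ∘L T ∘L
        ContinuousLinearMap.adjoint Φ.toContinuousLinearMap) S)
    (h0 : (0 : HZ →L[ℂ] HZ) ∈ M)
    (hw : Φ.toContinuousLinearMap ∘L ι.toContinuousLinearMap ∈ M) :
    ∃ (τ : (HX →L[ℂ] HX) → (H₀ →L[ℂ] H₀)) (V : H₀ →ₗᵢ[ℂ] H₀), IsStarRepOn R τ ∧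
      ∀ T ∈ A, ι.toContinuousLinearMap ∘L T ∘L
          ContinuousLinearMap.adjoint ι.toContinuousLinearMap ∈ R → ∀ v,
        τ (ι.toContinuousLinearMap ∘L T ∘L
          ContinuousLinearMap.adjoint ι.toContinuousLinearMap) (V v) = V (σ T v) := by
  set c : (HX →L[ℂ] HX) → (HZ →L[ℂ] HZ) := fun T => Φ.toContinuousLinearMap ∘L T ∘L
    ContinuousLinearMap.adjoint Φ.toContinuousLinearMap with hc
  have hΦΦ : ∀ v, ContinuousLinearMap.adjoint Φ.toContinuousLinearMap (Φ v) = v :=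
    fun v => DFunLike.congr_fun Φ.adjoint_comp_self v
  have hιι : ∀ v, ContinuousLinearMap.adjoint ι.toContinuousLinearMap (ι v) = v :=
    fun v => DFunLike.congr_fun ι.adjoint_comp_self v
  choose! τ hτ using fun T hT => (hΦ T hT).2
  let τ' : (HX →L[ℂ] HX) → (H₀ →L[ℂ] H₀) := fun T =>
    if h : ∃ S, Implements A σ (c T) S then h.choose else 0
  have hτ' : ∀ T S, Implements A σ (c T) S → τ' T = S := by
    intro T S hS
    have h : ∃ S, Implements A σ (c T) S := ⟨S, hS⟩
    simp only [τ', dif_pos h]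
    exact h.choose_spec.unique hnd hS
  have hττ : ∀ T ∈ R, τ' T = τ T := fun T hT => hτ' T _ (hτ T hT)
  set w := Φ.toContinuousLinearMap ∘L ι.toContinuousLinearMap with hw'
  have hww : star w * w = 1 := by
    rw [ContinuousLinearMap.star_eq_adjoint, ContinuousLinearMap.adjoint_comp]
    ext1 v
    change ContinuousLinearMap.adjoint ι.toContinuousLinearMap
      (ContinuousLinearMap.adjoint Φ.toContinuousLinearMap (Φ (ι v))) = v
    rw [hΦΦ, hιι]
  obtain ⟨S, hS⟩ := Implements.exists_of_star_mul_add hA hσ hnd hw h0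
    (by rw [hww, mul_zero, add_zero])
  have hSS : star S * S = 1 := by
    have := (hS.star hA hσ hnd hw).mul hA hw hS
    rw [hww] at this
    exact this.unique hnd Implements.one
  have hSn : ∀ v, ‖S v‖ = ‖v‖ :=
    (ContinuousLinearMap.norm_map_iff_adjoint_comp_self S).2 hSS
  refine ⟨τ', ⟨S.toLinearMap, hSn⟩, ⟨fun T hT T' hT' => ?_, fun k T hT => ?_,
    fun T hT T' hT' => ?_, fun T hT => ?_⟩, fun T hT hT' v => ?_⟩
  · rw [hττ T hT, hττ T' hT']
    refine hτ' _ _ ?_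
    have : c (T + T') = c T + c T' := by
      simp only [hc, ContinuousLinearMap.add_comp, ContinuousLinearMap.comp_add]
    rw [this]
    exact (hτ T hT).add hA hσ (hΦ T hT).1 (hΦ T' hT').1 (hτ T' hT')
  · rw [hττ T hT]
    refine hτ' _ _ ?_
    have : c (k • T) = k • c T := by
      simp only [hc, ContinuousLinearMap.smul_comp, ContinuousLinearMap.comp_smul]
    rw [this]
    exact (hτ T hT).smul hA hσ (hΦ T hT).1 k
  · rw [hττ T hT, hττ T' hT']
    refine hτ' _ _ ?_
    have : c (T * T') = c T * c T' := by
      ext1 v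
      change Φ (T (T' _)) = Φ (T (ContinuousLinearMap.adjoint Φ.toContinuousLinearMap (Φ (T' _))))
      rw [hΦΦ]
    rw [this]
    exact (hτ T hT).mul hA (hΦ T' hT').1 (hτ T' hT')
  · rw [hττ T hT]
    refine hτ' _ _ ?_
    have : c (star T) = star (c T) := by
      simp only [hc, ContinuousLinearMap.star_eq_adjoint, ContinuousLinearMap.adjoint_comp,
        ContinuousLinearMap.adjoint_adjoint, ContinuousLinearMap.comp_assoc]
    rw [this]
    exact (hτ T hT).star hA hσ hnd (hΦ T hT).1
  · rw [hττ _ hT']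
    have h := (hτ _ hT').mul hA hw hS
    have hcw : c (ι.toContinuousLinearMap ∘L T ∘L
        ContinuousLinearMap.adjoint ι.toContinuousLinearMap) * w = w * T := by
      ext1 v
      change Φ (ι (T (ContinuousLinearMap.adjoint ι.toContinuousLinearMap
        (ContinuousLinearMap.adjoint Φ.toContinuousLinearMap (Φ (ι v)))))) = Φ (ι (T v))
      rw [hΦΦ, hιι]
    have h2 := hS.mul hA (hA.subset hT) (Implements.self hσ hT)
    have heq := (hcw ▸ h : Implements A σ (w * T) _).unique hnd h2
    exact DFunLike.congr_fun heq v

end Compression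

section Extension

variable {Γ SX SZ Y F : Type*} [Group Γ] [DecidableEq Γ] [DecidableEq SX] [DecidableEq SZ]
  [PseudoMetricSpace Y] [NormedAddCommGroup F] [InnerProductSpace ℂ F] [CompleteSpace F]
  [MulAction Γ SX] [MulAction Γ SZ]
  {uX : Γ →* unitary (lp (fun _ : SX => F) 2 →L[ℂ] lp (fun _ : SX => F) 2)} {posX : SX → Y}
  {uZ : Γ →* unitary (lp (fun _ : SZ => F) 2 →L[ℂ] lp (fun _ : SZ => F) 2)} {posZ : SZ → Y}
  {i : SZ → SX}

theorem restrictProj_comp_extendIsom (hi : i.Injective) (s : Set SX) :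
    restrictProj F s ∘L (extendIsom F i hi).toContinuousLinearMap
      = (extendIsom F i hi).toContinuousLinearMap ∘L restrictProj F (i ⁻¹' s) := by
  ext v x
  change restrictProj F s (extendIsom F i hi v) x = extendIsom F i hi (restrictProj F (i ⁻¹' s) v) x
  by_cases hx : ∃ z, i z = x
  · obtain ⟨z, rfl⟩ := hx
    rw [extendIsom_apply (hf := hi)]
    by_cases hz : i z ∈ s
    · rw [restrictProj_apply_of_mem _ hz, restrictProj_apply_of_mem _ (s := i ⁻¹' s) hz,
        extendIsom_apply (hf := hi)]
    · rw [restrictProj_apply_of_notMem _ hz, restrictProj_apply_of_notMem _ (s := i ⁻¹' s) hz]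
  · push Not at hx
    rw [extendIsom_apply_of_notMem (hf := hi) _ hx]
    by_cases hs : x ∈ s
    · rw [restrictProj_apply_of_mem _ hs, extendIsom_apply_of_notMem (hf := hi) _ hx]
    · rw [restrictProj_apply_of_notMem _ hs]

theorem adjoint_extendIsom_comp_restrictProj (hi : i.Injective) (s : Set SX) :
    ContinuousLinearMap.adjoint (extendIsom F i hi).toContinuousLinearMap ∘L restrictProj F s
      = restrictProj F (i ⁻¹' s) ∘L
        ContinuousLinearMap.adjoint (extendIsom F i hi).toContinuousLinearMap := by
  have := congrArg ContinuousLinearMap.adjoint (restrictProj_comp_extendIsom (F := F) hi s)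
  rwa [ContinuousLinearMap.adjoint_comp, ContinuousLinearMap.adjoint_comp, adjoint_restrictProj,
    adjoint_restrictProj] at this

theorem isCompactOperator_mul_conj {HX HZ : Type*} [NormedAddCommGroup HX]
    [InnerProductSpace ℂ HX] [NormedAddCommGroup HZ] [InnerProductSpace ℂ HZ] {E : HZ →L[ℂ] HX}
    {E' : HX →L[ℂ] HZ} {P : HX →L[ℂ] HX} {P' T : HZ →L[ℂ] HZ} (h : P ∘L E = E ∘L P')
    (hc : IsCompactOperator (P' * T)) : IsCompactOperator (P * (E ∘L T ∘L E')) := by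
  have : P * (E ∘L T ∘L E') = E ∘L (P' * T) ∘L E' := by
    ext1 v
    exact DFunLike.congr_fun h (T (E' v))
  rw [this]
  exact (hc.comp_clm E').clm_comp E

theorem isCompactOperator_conj_mul {HX HZ : Type*} [NormedAddCommGroup HX]
    [InnerProductSpace ℂ HX] [NormedAddCommGroup HZ] [InnerProductSpace ℂ HZ] {E : HZ →L[ℂ] HX}
    {E' : HX →L[ℂ] HZ} {P : HX →L[ℂ] HX} {P' T : HZ →L[ℂ] HZ} (h : E' ∘L P = P' ∘L E')
    (hc : IsCompactOperator (T * P')) : IsCompactOperator ((E ∘L T ∘L E') * P) := by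
  have : (E ∘L T ∘L E') * P = E ∘L (T * P') ∘L E' := by
    ext1 v
    exact congrArg (fun y => E (T y)) (DFunLike.congr_fun h v)
  rw [this]
  exact (hc.comp_clm E').clm_comp E

/-- Extension by zero along an equivariant injection maps the equivariant Roe algebra of the
subspace into that of the ambient space. -/
theorem extendIsom_conj_mem_equivariantRoe
    (huX : ∀ γ x ξ, (uX γ : lp (fun _ : SX => F) 2 →L[ℂ] lp (fun _ : SX => F) 2)
      (lp.single 2 x ξ) = lp.single 2 (γ • x) ξ)
    (huZ : ∀ γ x ξ, (uZ γ : lp (fun _ : SZ => F) 2 →L[ℂ] lp (fun _ : SZ => F) 2)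
      (lp.single 2 x ξ) = lp.single 2 (γ • x) ξ)
    (hi : i.Injective) (hiΓ : ∀ (γ : Γ) z, i (γ • z) = γ • i z)
    (hpos : ∀ z, posX (i z) = posZ z)
    {T : lp (fun _ : SZ => F) 2 →L[ℂ] lp (fun _ : SZ => F) 2} (hT : T ∈ equivariantRoe uZ posZ) :
    (extendIsom F i hi).toContinuousLinearMap ∘L T ∘L
        ContinuousLinearMap.adjoint (extendIsom F i hi).toContinuousLinearMap
      ∈ equivariantRoe uX posX := by
  obtain ⟨hTu, hTc, R, hR⟩ := hT
  refine ⟨isEquivariantOp_conj (fun γ => lp_clm_ext fun z ξ => ?_) hTu, fun s hs => ?_, R,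
    fun y x ξ hxy => ?_⟩
  · change extendIsom F i hi ((uZ γ : lp (fun _ : SZ => F) 2 →L[ℂ] lp (fun _ : SZ => F) 2)
      (lp.single 2 z ξ)) = (uX γ : lp (fun _ : SX => F) 2 →L[ℂ] lp (fun _ : SX => F) 2)
        (extendIsom F i hi (lp.single 2 z ξ))
    rw [huZ, extendIsom_single, extendIsom_single, huX, hiΓ]
  · have hs' : Bornology.IsBounded (posZ '' (i ⁻¹' s)) := by
      refine hs.subset ?_
      rintro _ ⟨z, hz, rfl⟩
      exact ⟨i z, hz, hpos z⟩
    obtain ⟨h1, h2⟩ := hTc _ hs'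
    exact ⟨isCompactOperator_mul_conj (restrictProj_comp_extendIsom hi s) h1,
      isCompactOperator_conj_mul (adjoint_extendIsom_comp_restrictProj hi s) h2⟩
  · change extendIsom F i hi (T (ContinuousLinearMap.adjoint
      (extendIsom F i hi).toContinuousLinearMap (lp.single 2 y ξ))) x = 0
    by_cases hy : ∃ z, i z = y
    · obtain ⟨z, rfl⟩ := hy
      rw [extendIsom_adjoint_single (hf := hi)]
      by_cases hx : ∃ z, i z = x
      · obtain ⟨z', rfl⟩ := hx
        rw [extendIsom_apply (hf := hi)]
        exact hR _ _ _ (by rwa [hpos, hpos] at hxy)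
      · push Not at hx
        exact extendIsom_apply_of_notMem (hf := hi) _ hx
    · push Not at hy
      rw [extendIsom_adjoint_single_of_notMem (hf := hi) hy, map_zero, map_zero]
      rfl

variable [MulAction Γ Y] [IsIsometricSMul Γ Y] {g : SX → Γ} {W : SX → F →ₗᵢ[ℂ] F}
  {hW : ∀ x y, x ≠ y → ∀ ξ η, inner ℂ (W x ξ) (W y η) = 0} {d₀ : SZ}
  {hd₀ : (fun η : Γ => η • d₀).Injective}

theorem collapse_comp_extendIsom_mem_equivariantFinProp
    (huZ : ∀ γ x ξ, (uZ γ : lp (fun _ : SZ => F) 2 →L[ℂ] lp (fun _ : SZ => F) 2)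
      (lp.single 2 x ξ) = lp.single 2 (γ • x) ξ)
    (hg : ∀ γ x, g (γ • x) = γ * g x)
    (hi : i.Injective) (hiΓ : ∀ (γ : Γ) z, i (γ • z) = γ • i z)
    {C : ℝ} (hC : ∀ z, dist (posZ (g (i z) • d₀)) (posZ z) ≤ C) :
    (collapse g W hW d₀ hd₀).toContinuousLinearMap ∘L (extendIsom F i hi).toContinuousLinearMap
      ∈ equivariantFinProp uZ posZ := by
  have hsingle : ∀ z ξ, ((collapse g W hW d₀ hd₀).toContinuousLinearMap ∘L
      (extendIsom F i hi).toContinuousLinearMap) (lp.single 2 z ξ)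
        = lp.single 2 (g (i z) • d₀) (W ((g (i z))⁻¹ • i z) ξ) := fun z ξ => by
    change collapse g W hW d₀ hd₀ (extendIsom F i hi (lp.single 2 z ξ)) = _
    rw [extendIsom_single, collapse, blockIsom_single]
  refine ⟨isEquivariantOp_of_single huZ fun γ z ξ => ?_, C, fun z x ξ hzx => ?_⟩
  · rw [hsingle, hsingle, huZ, hiΓ, hg, smul_smul, smul_smul, mul_inv_rev, inv_mul_cancel_right]
  · rw [hsingle]
    refine lp.single_apply_ne _ _ _ fun h => ?_
    rw [h] at hzx
    exact (hC z).not_gt hzx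

theorem nonempty_repExtensionWitness_of_collapse {H₀ : Type} [NormedAddCommGroup H₀]
    [InnerProductSpace ℂ H₀] [CompleteSpace H₀]
    {σ : (lp (fun _ : SZ => F) 2 →L[ℂ] lp (fun _ : SZ => F) 2) → (H₀ →L[ℂ] H₀)}
    (huX : ∀ γ x ξ, (uX γ : lp (fun _ : SX => F) 2 →L[ℂ] lp (fun _ : SX => F) 2)
      (lp.single 2 x ξ) = lp.single 2 (γ • x) ξ)
    (huZ : ∀ γ x ξ, (uZ γ : lp (fun _ : SZ => F) 2 →L[ℂ] lp (fun _ : SZ => F) 2)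
      (lp.single 2 x ξ) = lp.single 2 (γ • x) ξ)
    (hposZ : ∀ (γ : Γ) x, posZ (γ • x) = γ • posZ x)
    (hi : i.Injective) (hiΓ : ∀ (γ : Γ) z, i (γ • z) = γ • i z) (hpos : ∀ z, posX (i z) = posZ z)
    (hg : ∀ γ x, g (γ • x) = γ * g x)
    (hW : ∀ x y, x ≠ y → ∀ ξ η, inner ℂ (W x ξ) (W y η) = 0)
    (hd₀ : (fun η : Γ => η • d₀).Injective)
    (hcover : ∀ R, ∃ s : Finset Γ, ∀ x y, dist (posX x) (posX y) ≤ R → (g x)⁻¹ * g y ∈ s)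
    {C : ℝ} (hC : ∀ z, dist (posZ (g (i z) • d₀)) (posZ z) ≤ C)
    {Ext : (lp (fun _ : SZ => F) 2 →L[ℂ] lp (fun _ : SZ => F) 2) →
      (lp (fun _ : SX => F) 2 →L[ℂ] lp (fun _ : SX => F) 2) → Prop}
    (hExt : ∀ T T', Ext T T' ↔ T' = (extendIsom F i hi).toContinuousLinearMap ∘L T ∘L
      ContinuousLinearMap.adjoint (extendIsom F i hi).toContinuousLinearMap)
    (hσ : IsStarRepOn (equivariantRoe uZ posZ) σ)
    (hnd : IsNondegRepOn (equivariantRoe uZ posZ) σ) :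
    Nonempty (RepExtensionWitness (equivariantRoe uZ posZ) (equivariantRoe uX posX) Ext σ) := by
  obtain ⟨τ, V, hτ, hV⟩ := exists_starRep_of_compression (R := equivariantRoe uX posX)
    isMultiplierPair_equivariantRoe hσ hnd (collapse g W hW d₀ hd₀) (extendIsom F i hi)
    (fun T hT => collapse_conj_mem_implementedMultipliers huX huZ hg hcover hposZ hσ hnd hT.1
      hT.2.2.choose_spec) (zero_mem _)
    (collapse_comp_extendIsom_mem_equivariantFinProp huZ hg hi hiΓ hC)
  have hmem := fun T hT => extendIsom_conj_mem_equivariantRoe (T := T) huX huZ hi hiΓ hpos hT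
  refine nonempty_repExtensionWitness hnd hτ (fun T hT => star_mem_equivariantRoe hT)
    (fun T hT => ⟨_, hmem T hT, (hExt _ _).2 rfl⟩) V fun T hT T' hTT' => ?_
  rw [(hExt T T').1 hTT']
  exact hV T hT (hmem T hT)

end Extension

section Geometry

theorem equivariantRoe_comp_isometry {Γ S Y Y' F : Type*} [Group Γ] [DecidableEq S]
    [PseudoMetricSpace Y] [PseudoMetricSpace Y'] [NormedAddCommGroup F] [InnerProductSpace ℂ F]
    [CompleteSpace F] (u : Γ →* unitary (lp (fun _ : S => F) 2 →L[ℂ] lp (fun _ : S => F) 2))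
    (pos : S → Y) {f : Y → Y'} (hf : Isometry f) :
    equivariantRoe u (fun x => f (pos x)) = equivariantRoe u pos := by
  ext T
  simp only [equivariantRoe, BlockLocCompact, BlockPropLE, hf.dist_eq, Metric.isBounded_iff,
    Set.forall_mem_image]

/-- A countable family of isometries of `ℓ²(ℕ)` with pairwise orthogonal ranges. -/
theorem exists_orthogonal_isometries (S : Type*) [Countable S] :
    ∃ W : S → L2N →ₗᵢ[ℂ] L2N, ∀ x y, x ≠ y → ∀ ξ η, inner ℂ (W x ξ) (W y η) = 0 := by
  obtain ⟨J, hJ⟩ := exists_injective_nat (S × ℕ)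
  have hJx : ∀ x : S, (fun n => J (x, n)).Injective := fun x m n h => (Prod.ext_iff.1 (hJ h)).2
  refine ⟨fun x => extendIsom ℂ (fun n => J (x, n)) (hJx x), fun x y hxy ξ η => ?_⟩
  rw [lp.inner_eq_tsum]
  refine (tsum_congr fun n => ?_).trans tsum_zero
  by_cases hn : ∃ k, J (x, k) = n
  · obtain ⟨k, rfl⟩ := hn
    rw [extendIsom_apply_of_notMem (hf := hJx y) η fun m h => hxy (Prod.ext_iff.1 (hJ h)).1.symm,
      inner_zero_right]
  · push Not at hn
    rw [extendIsom_apply_of_notMem (hf := hJx x) ξ hn, inner_zero_left]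

theorem unitary_single_of_apply {Γ S F : Type*} [Group Γ] [MulAction Γ S] [DecidableEq S]
    [NormedAddCommGroup F] [InnerProductSpace ℂ F] [CompleteSpace F]
    {u : Γ →* unitary (lp (fun _ : S => F) 2 →L[ℂ] lp (fun _ : S => F) 2)}
    (hu : ∀ (γ : Γ) v (x : S),
      (u γ : lp (fun _ : S => F) 2 →L[ℂ] lp (fun _ : S => F) 2) v (γ • x) = v x)
    (γ : Γ) (x : S) (ξ : F) :
    (u γ : lp (fun _ : S => F) 2 →L[ℂ] lp (fun _ : S => F) 2) (lp.single 2 x ξ)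
      = lp.single 2 (γ • x) ξ := by
  ext y : 2
  obtain ⟨y, rfl⟩ := MulAction.surjective γ y
  rw [hu]
  by_cases h : y = x
  · subst h
    rw [lp.single_apply_self, lp.single_apply_self]
  · rw [lp.single_apply_ne _ _ _ h,
      lp.single_apply_ne _ _ _ ((MulAction.injective γ).ne h)]

variable {X Γ : Type*} [MetricSpace X] [Group Γ] [MulAction Γ X] [IsIsometricSMul Γ X] {D S : Set X}

theorem eq_of_mem_smul_of_mem_smul
    (hdisj : ∀ γ₁ γ₂ : Γ, γ₁ ≠ γ₂ → Disjoint (γ₁ • D) (γ₂ • D)) {γ₁ γ₂ : Γ} {x : X}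
    (h₁ : x ∈ γ₁ • D) (h₂ : x ∈ γ₂ • D) : γ₁ = γ₂ := by
  by_contra h
  exact Set.disjoint_left.1 (hdisj _ _ h) h₁ h₂

theorem exists_finset_translates
    (hdisj : ∀ γ₁ γ₂ : Γ, γ₁ ≠ γ₂ → Disjoint (γ₁ • D) (γ₂ • D))
    (hS : ∀ (γ : Γ), ∀ x ∈ S, γ • x ∈ S)
    (hcover : ∀ r : ℝ, 0 < r → ∃ s : Finset Γ,
      ∀ x ∈ Metric.thickening r D ∩ S, ∃ γ ∈ s, x ∈ γ • D)
    {g : S → Γ} (hg : ∀ x : S, (x : X) ∈ g x • D) (R : ℝ) :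
    ∃ s : Finset Γ, ∀ x y : S, dist (x : X) (y : X) ≤ R → (g x)⁻¹ * g y ∈ s := by
  obtain ⟨s, hs⟩ := hcover (|R| + 1) (by positivity)
  refine ⟨s, fun x y hxy => ?_⟩
  have hx : (g x)⁻¹ • (x : X) ∈ D := Set.mem_smul_set_iff_inv_smul_mem.1 (hg x)
  obtain ⟨γ, hγ, hmem⟩ := hs ((g x)⁻¹ • (y : X)) ⟨Metric.mem_thickening_iff.2 ⟨_, hx, by
    rw [dist_smul, dist_comm]; linarith [le_abs_self R]⟩, hS _ _ y.2⟩
  have : (g x)⁻¹ • (y : X) ∈ ((g x)⁻¹ * g y) • D := by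
    rw [mul_smul]
    exact Set.smul_mem_smul_set (hg y)
  rwa [eq_of_mem_smul_of_mem_smul hdisj this hmem]

theorem exists_dist_orbit_le
    (hdisj : ∀ γ₁ γ₂ : Γ, γ₁ ≠ γ₂ → Disjoint (γ₁ • D) (γ₂ • D))
    (hS : ∀ (γ : Γ), ∀ x ∈ S, γ • x ∈ S)
    (hcover : ∀ r : ℝ, 0 < r → ∃ s : Finset Γ,
      ∀ x ∈ Metric.thickening r D ∩ S, ∃ γ ∈ s, x ∈ γ • D)
    {Z : Set X} (hZ : ∀ (γ : Γ), ∀ z ∈ Z, γ • z ∈ Z)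
    (hZcocompact : ∃ K : Set X, IsCompact K ∧ ∀ z ∈ Z, ∃ γ : Γ, ∃ k ∈ K ∩ Z, z = γ • k)
    {g : S → Γ} (hg : ∀ x : S, (x : X) ∈ g x • D) {d₀ : X} (hd₀ : d₀ ∈ D) :
    ∃ C : ℝ, ∀ z : S, (z : X) ∈ Z → dist (g z • d₀) (z : X) ≤ C := by
  obtain ⟨K, hK, hKZ⟩ := hZcocompact
  obtain ⟨r, hr, hKr⟩ := hK.isBounded.subset_ball_lt 0 d₀
  obtain ⟨s, hs⟩ := hcover r hr
  refine ⟨∑ γ ∈ s, dist (γ • d₀) d₀ + r, fun z hz => ?_⟩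
  obtain ⟨γ, k, ⟨hk, -⟩, hγk⟩ := hKZ _ (hZ (g z)⁻¹ _ hz)
  have hk' : k = γ⁻¹ • (g z)⁻¹ • (z : X) := by rw [hγk, inv_smul_smul]
  have hkD : k ∈ γ⁻¹ • D := by
    rw [hk']
    exact Set.smul_mem_smul_set (Set.mem_smul_set_iff_inv_smul_mem.1 (hg z))
  obtain ⟨γ', hγ', hmem⟩ := hs k ⟨Metric.mem_thickening_iff.2 ⟨d₀, hd₀, hKr hk⟩, by
    rw [hk']; exact hS _ _ (hS _ _ z.2)⟩
  obtain rfl := eq_of_mem_smul_of_mem_smul hdisj hkD hmem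
  calc dist (g z • d₀) (z : X) = dist (γ⁻¹ • d₀) k := by
        rw [hk', dist_smul, ← dist_smul (g z) d₀, smul_inv_smul]
    _ ≤ dist (γ⁻¹ • d₀) d₀ + dist d₀ k := dist_triangle _ _ _
    _ ≤ ∑ γ ∈ s, dist (γ • d₀) d₀ + r := add_le_add
        (Finset.single_le_sum (f := fun γ => dist (γ • d₀) d₀) (fun _ _ => dist_nonneg) hγ')
        (by rw [dist_comm]; exact (hKr hk).le)

/-- The action on an invariant subset. -/
abbrev restrictedAction (hS : ∀ (γ : Γ), ∀ x ∈ S, γ • x ∈ S) : MulAction Γ S where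
  smul γ x := ⟨γ • (x : X), hS γ x x.2⟩
  one_smul x := Subtype.ext (one_smul Γ (x : X))
  mul_smul γ γ' x := Subtype.ext (mul_smul γ γ' (x : X))

end Geometry

section ExtensionByZero

variable {X : Type*} [MetricSpace X] {ΓX Z : Set X}

theorem extZeroRel_iff {T : L2S (ΓX ∩ Z) →L[ℂ] L2S (ΓX ∩ Z)} {T' : L2S ΓX →L[ℂ] L2S ΓX} :
    ExtZeroRel ΓX Z T T' ↔
      T' = (extendIsom L2N _ (Set.inclusion_injective
          (Set.inter_subset_left : ΓX ∩ Z ⊆ ΓX))).toContinuousLinearMap ∘L T ∘L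
        ContinuousLinearMap.adjoint (extendIsom L2N _ (Set.inclusion_injective
          (Set.inter_subset_left : ΓX ∩ Z ⊆ ΓX))).toContinuousLinearMap := by
  have hi := Set.inclusion_injective (Set.inter_subset_left : ΓX ∩ Z ⊆ ΓX)
  have hout : ∀ x : ΓX, (x : X) ∉ Z →
      ∀ z, Set.inclusion (Set.inter_subset_left : ΓX ∩ Z ⊆ ΓX) z ≠ x := by
    rintro x hx z rfl
    exact hx z.2.2
  have hconj1 : ∀ (z : ↥(ΓX ∩ Z)) (ξ : L2N), ((extendIsom L2N _ hi).toContinuousLinearMap ∘L T ∘L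
      ContinuousLinearMap.adjoint (extendIsom L2N _ hi).toContinuousLinearMap)
        (lp.single 2 (Set.inclusion Set.inter_subset_left z) ξ)
      = extendIsom L2N _ hi (T (lp.single 2 z ξ)) := fun z ξ =>
    congrArg (fun v => extendIsom L2N _ hi (T v)) (extendIsom_adjoint_single (hf := hi) z ξ)
  have hconj2 : ∀ x : ΓX, (x : X) ∉ Z → ∀ ξ : L2N,
      ((extendIsom L2N _ hi).toContinuousLinearMap ∘L T ∘L
        ContinuousLinearMap.adjoint (extendIsom L2N _ hi).toContinuousLinearMap)
          (lp.single 2 x ξ) = 0 := fun x hx ξ => by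
    change extendIsom L2N _ hi (T (ContinuousLinearMap.adjoint
      (extendIsom L2N _ hi).toContinuousLinearMap (lp.single 2 x ξ))) = 0
    rw [extendIsom_adjoint_single_of_notMem (hf := hi) (hout x hx), map_zero, map_zero]
  constructor
  · rintro ⟨h1, h2, h3⟩
    refine lp_clm_ext fun y ξ => ?_
    by_cases hy : (y : X) ∈ Z
    · refine Eq.trans ?_ (hconj1 ⟨y, y.2, hy⟩ ξ).symm
      ext x : 2
      by_cases hx : (x : X) ∈ Z
      · exact (h1 ⟨y, y.2, hy⟩ ⟨x, x.2, hx⟩ ξ).trans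
          (extendIsom_apply (hf := hi) _ ⟨x, x.2, hx⟩).symm
      · rw [extendIsom_apply_of_notMem (hf := hi) _ (hout x hx)]
        exact h3 ⟨y, y.2, hy⟩ ξ x hx
    · rw [h2 y hy, hconj2 y hy]
  · rintro rfl
    refine ⟨fun y x ξ => ?_, fun y hy ξ => hconj2 y hy ξ, fun y ξ x hx => ?_⟩
    · exact (congrArg (fun v : L2S ΓX => v _) (hconj1 y ξ)).trans
        (extendIsom_apply (hf := hi) (T (lp.single 2 y ξ)) x)
    · exact (congrArg (fun v : L2S ΓX => v _) (hconj1 y ξ)).trans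
        (extendIsom_apply_of_notMem (hf := hi) _ (hout x hx))

/-- Over a trivial space every nondegenerate representation is zero. -/
theorem nonempty_repExtensionWitness_of_subsingleton {HZ HX : Type*} {H₀ : Type}
    [NormedAddCommGroup HZ] [InnerProductSpace ℂ HZ] [CompleteSpace HZ]
    [NormedAddCommGroup HX] [InnerProductSpace ℂ HX] [CompleteSpace HX]
    [NormedAddCommGroup H₀] [InnerProductSpace ℂ H₀] [CompleteSpace H₀]
    {RZ : Set (HZ →L[ℂ] HZ)} {RX : Set (HX →L[ℂ] HX)}
    {Ext : (HZ →L[ℂ] HZ) → (HX →L[ℂ] HX) → Prop}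
    {σ : (HZ →L[ℂ] HZ) → (H₀ →L[ℂ] H₀)} [Subsingleton HZ] (hσ : IsStarRepOn RZ σ)
    (hnd : IsNondegRepOn RZ σ) : Nonempty (RepExtensionWitness RZ RX Ext σ) := by
  have hzero : ∀ T ∈ RZ, σ T = 0 := fun T hT => by
    have h0 : (0 : ℂ) • T = T := ContinuousLinearMap.ext fun _ => Subsingleton.elim _ _
    have := hσ.2.1 0 T hT
    rwa [h0, zero_smul] at this
  have hid : (0 : H₀ →L[ℂ] H₀) = 1 := clm_eq_of_nondeg hnd fun T hT v => by
    rw [hzero T hT]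
    rfl
  have hsub : Subsingleton H₀ := subsingleton_of_forall_eq 0 fun v =>
    (DFunLike.congr_fun hid v).symm
  exact ⟨{
    carrier := H₀
    isom := LinearIsometry.id
    hatRep := fun _ => 0
    isStarRep := ⟨fun _ _ _ _ => (add_zero _).symm, fun c _ _ => (smul_zero c).symm,
      fun _ _ _ _ => (mul_zero _).symm, fun _ _ => (star_zero _).symm⟩
    isNondeg := fun v => subset_closure (by
      rw [Subsingleton.elim v 0]
      exact zero_mem _)
    intertwines := fun _ _ _ _ _ => Subsingleton.elim _ _ }⟩

end ExtensionByZero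

/-- For a convenient action of `Γ` on `X` and a closed Γ-invariant
subset `Z` on which `Γ` acts cocompactly, every nondegenerate `*`-representation of
`ℝ(Z)^Γ` (regarded inside `ℝ(X)^Γ` via extension by zero) extends to a nondegenerate
`*`-representation of `ℝ(X)^Γ`. -/
theorem nondeg_rep_of_relative_Roe_extends
    {X : Type*} [MetricSpace X] [ProperSpace X] [TopologicalSpace.SeparableSpace X]
    {Γ : Type*} [Group Γ] [MulAction Γ X] [ProperlyDiscontinuousSMul Γ X]
    (hiso : ∀ γ : Γ, Isometry fun x : X => γ • x)
    (hfree : ∀ (γ : Γ) (x : X), γ • x = x → γ = 1)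
    (D ΓX : Set X)
    (hdisj : ∀ γ₁ γ₂ : Γ, γ₁ ≠ γ₂ → Disjoint (γ₁ • D) (γ₂ • D))
    (hΓX : ΓX = ⋃ γ : Γ, γ • D)
    (hcountable : ΓX.Countable) (hdense : Dense ΓX)
    -- the action is convenient:
    (hsep : ∃ c : ℝ, 0 < c ∧ ∀ (γ : Γ), γ ≠ 1 → ∀ x : X, c < dist x (γ • x))
    (hcover : ∀ r : ℝ, 0 < r → ∃ F : Finset Γ,
      ∀ x ∈ Metric.thickening r D ∩ ΓX, ∃ γ ∈ F, x ∈ γ • D)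
    -- `Z` is closed, Γ-invariant, with cocompact Γ-action, and `Γ_X ∩ Z` is dense in `Z`
    (Z : Set X) (hZclosed : IsClosed Z) (hZinv : ∀ (γ : Γ), ∀ z ∈ Z, γ • z ∈ Z)
    (hZcocompact : ∃ K : Set X, IsCompact K ∧ ∀ z ∈ Z, ∃ γ : Γ, ∃ k ∈ K ∩ Z, z = γ • k)
    (hdenseZ : ∀ z ∈ Z, z ∈ closure (ΓX ∩ Z))
    -- the multiplication representation of `C₀(X)` on `H_X = ℓ²(Γ_X) ⊗ ℓ²(ℕ)`
    (ρX : C₀(X, ℂ) →⋆ₙₐ[ℂ] (L2S ΓX →L[ℂ] L2S ΓX))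
    (hρX : ∀ (f : C₀(X, ℂ)) (v : L2S ΓX) (x : ↥ΓX), (ρX f v) x = f (x : X) • v x)
    (uX : Γ →* unitary (L2S ΓX →L[ℂ] L2S ΓX))
    (huX : ∀ (γ : Γ) (v : L2S ΓX) (x : ↥ΓX) (hγx : γ • (x : X) ∈ ΓX),
      ((uX γ : L2S ΓX →L[ℂ] L2S ΓX) v) (⟨γ • (x : X), hγx⟩ : ↥ΓX) = v x)
    -- the multiplication representation of `C₀(Z)` on `H_Z = ℓ²(Γ_X ∩ Z) ⊗ ℓ²(ℕ)`
    (ρZ : C₀((↥Z : Type _), ℂ) →⋆ₙₐ[ℂ] (L2S (ΓX ∩ Z) →L[ℂ] L2S (ΓX ∩ Z)))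
    (hρZ : ∀ (f : C₀((↥Z : Type _), ℂ)) (v : L2S (ΓX ∩ Z)) (x : ↥(ΓX ∩ Z)),
      (ρZ f v) x = f (⟨(x : X), x.2.2⟩ : ↥Z) • v x)
    (uZ : Γ →* unitary (L2S (ΓX ∩ Z) →L[ℂ] L2S (ΓX ∩ Z)))
    (huZ : ∀ (γ : Γ) (v : L2S (ΓX ∩ Z)) (x : ↥(ΓX ∩ Z)) (hγx : γ • (x : X) ∈ ΓX ∩ Z),
      ((uZ γ : L2S (ΓX ∩ Z) →L[ℂ] L2S (ΓX ∩ Z)) v) (⟨γ • (x : X), hγx⟩ : ↥(ΓX ∩ Z)) = v x) :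
    -- every nondegenerate `*`-representation of `ℝ(Z)^Γ` extends to `ℝ(X)^Γ`
    ∀ (H₀ : Type) [NormedAddCommGroup H₀] [InnerProductSpace ℂ H₀] [CompleteSpace H₀]
      (σ : (L2S (ΓX ∩ Z) →L[ℂ] L2S (ΓX ∩ Z)) → (H₀ →L[ℂ] H₀)),
      IsStarRepOn (RoeAlgSet ρZ uZ) σ → IsNondegRepOn (RoeAlgSet ρZ uZ) σ →
      Nonempty (RepExtensionWitness (RoeAlgSet ρZ uZ) (RoeAlgSet ρX uX)
        (ExtZeroRel ΓX Z) σ) := by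
  intro H₀ _ _ _ σ hσ hnd
  have : IsIsometricSMul Γ X := ⟨hiso⟩
  have : ProperSpace Z := ProperSpace.of_isClosed hZclosed
  have hΓXinv : ∀ (γ : Γ), ∀ x ∈ ΓX, γ • x ∈ ΓX := by
    intro γ x hx
    rw [hΓX, Set.mem_iUnion] at hx ⊢
    obtain ⟨η, hη⟩ := hx
    exact ⟨γ * η, by rw [mul_smul]; exact Set.smul_mem_smul_set hη⟩
  have hΓZinv : ∀ (γ : Γ), ∀ x ∈ ΓX ∩ Z, γ • x ∈ ΓX ∩ Z := fun γ x hx =>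
    ⟨hΓXinv γ x hx.1, hZinv γ x hx.2⟩
  have hRX : RoeAlgSet ρX uX = equivariantRoe uX ((↑) : ΓX → X) :=
    Set.ext fun T => mem_roeAlgSet_iff hρX
  have hRZ : RoeAlgSet ρZ uZ = equivariantRoe uZ ((↑) : ↥(ΓX ∩ Z) → X) :=
    (Set.ext fun T => mem_roeAlgSet_iff hρZ).trans
      (equivariantRoe_comp_isometry uZ (fun x : ↥(ΓX ∩ Z) => (⟨x, x.2.2⟩ : Z))
        isometry_subtype_coe).symm
  have hexists : ∀ x : ΓX, ∃ γ : Γ, (x : X) ∈ γ • D := fun x =>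
    Set.mem_iUnion.1 (hΓX.subset x.2)
  choose g hg using hexists
  by_cases hne : Nonempty ↥(ΓX ∩ Z)
  swap
  · have := not_nonempty_iff.1 hne
    have : Subsingleton (L2S (ΓX ∩ Z)) := ⟨fun v w => lp.ext (Subsingleton.elim _ _)⟩
    exact nonempty_repExtensionWitness_of_subsingleton hσ hnd
  obtain ⟨z₀⟩ := hne
  let d₀ : ↥(ΓX ∩ Z) := ⟨(g ⟨z₀, z₀.2.1⟩)⁻¹ • (z₀ : X), hΓZinv _ _ z₀.2⟩
  have hd₀D : (d₀ : X) ∈ D := Set.mem_smul_set_iff_inv_smul_mem.1 (hg ⟨z₀, z₀.2.1⟩)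
  let _ : MulAction Γ ΓX := restrictedAction hΓXinv
  let _ : MulAction Γ ↥(ΓX ∩ Z) := restrictedAction hΓZinv
  have hgsmul : ∀ (γ : Γ) (x : ΓX), g (γ • x) = γ * g x := fun γ x => by
    refine eq_of_mem_smul_of_mem_smul hdisj (hg _) ?_
    rw [mul_smul]
    exact Set.smul_mem_smul_set (hg x)
  have hd₀ : (fun η : Γ => η • d₀).Injective := by
    intro η κ h
    have h' : η • (d₀ : X) = κ • (d₀ : X) := congrArg Subtype.val h
    refine (inv_mul_eq_one.1 (hfree (η⁻¹ * κ) d₀ ?_))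
    rw [mul_smul, ← h', inv_smul_smul]
  have := hcountable.to_subtype
  obtain ⟨W, hW⟩ := exists_orthogonal_isometries ΓX
  obtain ⟨C, hC⟩ := exists_dist_orbit_le hdisj hΓXinv hcover hZinv hZcocompact hg hd₀D
  rw [hRZ] at hσ hnd ⊢
  rw [hRX]
  exact nonempty_repExtensionWitness_of_collapse
    (unitary_single_of_apply fun γ v x => huX γ v x _)
    (unitary_single_of_apply fun γ v x => huZ γ v x _)
    (fun _ _ => rfl) (Set.inclusion_injective Set.inter_subset_left) (fun _ _ => rfl)
    (fun _ => rfl) hgsmul hW hd₀ (exists_finset_translates hdisj hΓXinv hcover hg)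
    (fun z => hC _ z.2.2) (fun _ _ => extZeroRel_iff) hσ hnd
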